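/- arXiv:1810.11410 — 2 statements merged into one kernel-verified Lean document; each statement's English description precedes it below -/
import Mathlib

section
/- The Belavin R-matrix satisfies crossing symmetry: for generic ξ ∈ ℂ one has R₁₂(z)^{t₂} · R₂₁(z^{−1}q^{−N})^{t₂} = Id on ℂ^N ⊗ ℂ^N, where z = e^{iπξ}, the argument z^{−1}q^{−N} corresponds to −ξ − Nζ, t₂ denotes partial transposition in the second tensor factor, and R₂₁(w) = P · R(w) · P with P the flip operator P(u ⊗ v) = v ⊗ u. -/
open Complex Matrix Kronecker

noncomputable section

/-- `eπ x = exp(iπx)`; the variables `z, q, p` of the paper are `eπ ξ, eπ ζ, eπ (2τ)`. -/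
def eπ (x : ℂ) : ℂ := Complex.exp (Real.pi * Complex.I * x)

/-- Jacobi theta function with characteristics `ϑ[γ₁,γ₂](u,τ)`. -/
def jTheta (γ₁ γ₂ : ℝ) (u τ : ℂ) : ℂ :=
  ∑' m : ℤ, Complex.exp (Real.pi * Complex.I * ((m : ℂ) + (γ₁ : ℂ)) ^ 2 * τ +
    2 * Real.pi * Complex.I * ((m : ℂ) + (γ₁ : ℂ)) * (u + (γ₂ : ℂ)))

/-- single infinite Pochhammer symbol `(x;s)_∞`. -/
def poch1 (x s : ℂ) : ℂ := ∏' n : ℕ, (1 - x * s ^ n)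

/-- double infinite Pochhammer symbol `(x;p₁,p₂)_∞`. -/
def poch2 (x p₁ p₂ : ℂ) : ℂ := ∏' n : ℕ × ℕ, (1 - x * p₁ ^ n.1 * p₂ ^ n.2)

/-- Jacobi `Θ_s(x)` function. -/
def ThetaF (s x : ℂ) : ℂ := poch1 x s * poch1 (s * x⁻¹) s * poch1 s s

/-- numerator of `1/κ(z²)`, with `z = eπ ξ`, `q = eπ ζ`, `p = eπ (2τ)`. -/
def kappaNum (N : ℕ) (ξ ζ τ : ℂ) : ℂ :=
  poch2 (eπ (2 * N * ζ - 2 * ξ)) (eπ (2 * τ)) (eπ (2 * N * ζ)) *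
  poch2 (eπ (2 * ζ + 2 * ξ)) (eπ (2 * τ)) (eπ (2 * N * ζ)) *
  poch2 (eπ (2 * τ - 2 * ξ)) (eπ (2 * τ)) (eπ (2 * N * ζ)) *
  poch2 (eπ (2 * τ + (2 * N - 2) * ζ + 2 * ξ)) (eπ (2 * τ)) (eπ (2 * N * ζ))

/-- denominator of `1/κ(z²)`: the numerator with `ξ → -ξ`. -/
def kappaDen (N : ℕ) (ξ ζ τ : ℂ) : ℂ := kappaNum N (-ξ) ζ τ

/-- the diagonal matrix `g^{1/2}` with entries `e^{iπj/N}`, `1 ≤ j ≤ N`. -/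
def gHalf (N : ℕ) : Matrix (Fin N) (Fin N) ℂ :=
  Matrix.diagonal fun j => eπ ((((j : ℕ) : ℂ) + 1) / N)

/-- the diagonal matrix `g` with entries `ω^j = e^{2iπj/N}`, `1 ≤ j ≤ N`. -/
def gMat (N : ℕ) : Matrix (Fin N) (Fin N) ℂ :=
  Matrix.diagonal fun j => eπ (2 * (((j : ℕ) : ℂ) + 1) / N)

/-- the shift matrix `h`, `h_{jl} = δ_{j+1,l}` (mod `N`). -/
def hMat (N : ℕ) : Matrix (Fin N) (Fin N) ℂ :=
  Matrix.of fun j l => if (l : ℕ) = ((j : ℕ) + 1) % N then 1 else 0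

/-- `I_{(α₁,α₂)} = g^{α₂} h^{α₁}`. -/
def Imat (N : ℕ) (α : Fin N × Fin N) : Matrix (Fin N) (Fin N) ℂ :=
  gMat N ^ (α.2 : ℕ) * hMat N ^ (α.1 : ℕ)

/-- the coefficient `W_{(α₁,α₂)}(ξ,ζ,τ)`. -/
def Wcoef (N : ℕ) (α : Fin N × Fin N) (ξ ζ τ : ℂ) : ℂ :=
  jTheta (1/2 + (α.1 : ℕ) / N) (1/2 + (α.2 : ℕ) / N) (ξ + ζ / N) τ /
    (N * jTheta (1/2 + (α.1 : ℕ) / N) (1/2 + (α.2 : ℕ) / N) (ζ / N) τ)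

/-- the matrix `𝒵(z)`, `z = eπ ξ`. -/
def Zmat (N : ℕ) (ξ ζ τ : ℂ) : Matrix (Fin N × Fin N) (Fin N × Fin N) ℂ :=
  (eπ (ξ * (2 / N - 2)) * (kappaNum N ξ ζ τ / kappaDen N ξ ζ τ) *
      jTheta (1/2) (1/2) ζ τ / jTheta (1/2) (1/2) (ξ + ζ) τ) •
    ∑ α : Fin N × Fin N, Wcoef N α ξ ζ τ • (Imat N α ⊗ₖ (Imat N α)⁻¹)

/-- the Belavin R-matrix `R(z)`, as a function of `ξ` with `z = eπ ξ`. -/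
def Rmat (N : ℕ) (ξ ζ τ : ℂ) : Matrix (Fin N × Fin N) (Fin N × Fin N) ℂ :=
  (gHalf N ⊗ₖ gHalf N) * Zmat N ξ ζ τ * (gHalf N ⊗ₖ gHalf N)⁻¹

/-- genericity: every theta-function value and κ-value appearing in a denominator is nonzero. -/
def Rgeneric (N : ℕ) (ξ ζ τ : ℂ) : Prop :=
  jTheta (1/2) (1/2) (ξ + ζ) τ ≠ 0 ∧
  (∀ α : Fin N × Fin N,
    jTheta (1/2 + (α.1 : ℕ) / N) (1/2 + (α.2 : ℕ) / N) (ζ / N) τ ≠ 0) ∧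
  kappaDen N ξ ζ τ ≠ 0

/-- the flip (permutation) operator `P` on `ℂ^N ⊗ ℂ^N`. -/
def Pflip (N : ℕ) : Matrix (Fin N × Fin N) (Fin N × Fin N) ℂ :=
  Matrix.of fun a b => if a.1 = b.2 ∧ a.2 = b.1 then 1 else 0

/-- partial transposition in the second tensor factor. -/
def pt2 {N : ℕ} (M : Matrix (Fin N × Fin N) (Fin N × Fin N) ℂ) :
    Matrix (Fin N × Fin N) (Fin N × Fin N) ℂ :=
  Matrix.of fun a b => M (a.1, b.2) (b.1, a.2)

/-- `τ_N` evaluated at `eπ u` (all fractional powers via exponentials). -/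
def tauNe (N : ℕ) (ζ u : ℂ) : ℂ :=
  eπ (u * (2 / N - 2)) * ThetaF (eπ (2 * N * ζ)) (eπ (ζ + 2 * u)) /
    ThetaF (eπ (2 * N * ζ)) (eπ (ζ - 2 * u))

/-- the normalized Belavin R-matrix `R̂(z) = τ_N(q^{1/2}z⁻¹) R(z)`, as a function of `ξ`. -/
def Rhat (N : ℕ) (ξ ζ τ : ℂ) : Matrix (Fin N × Fin N) (Fin N × Fin N) ℂ :=
  tauNe N ζ (ζ / 2 - ξ) • Rmat N ξ ζ τ

lemma eπ_add (x y : ℂ) : eπ (x + y) = eπ x * eπ y := by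
  simp only [eπ, mul_add, Complex.exp_add]

lemma eπ_ne (x : ℂ) : eπ x ≠ 0 := Complex.exp_ne_zero _

lemma eπ_zero : eπ 0 = 1 := by simp [eπ]

lemma eπ_neg (x : ℂ) : eπ (-x) = (eπ x)⁻¹ := by
  simp only [eπ, mul_neg, Complex.exp_neg]

lemma eπ_sub (x y : ℂ) : eπ (x - y) = eπ x / eπ y := by
  rw [sub_eq_add_neg, eπ_add, eπ_neg, div_eq_mul_inv]

lemma eπ_one : eπ 1 = -1 := by simp [eπ, Complex.exp_pi_mul_I]

lemma eπ_two_int (n : ℤ) : eπ (2 * n) = 1 := by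
  rw [eπ, ← Complex.exp_int_mul_two_pi_mul_I n]; ring_nf

lemma eπ_two : eπ 2 = 1 := by simpa using eπ_two_int 1

lemma eπ_pow (x : ℂ) (n : ℕ) : eπ x ^ n = eπ (n * x) := by
  rw [eπ, eπ, ← Complex.exp_nat_mul]; ring_nf

lemma eπ_differentiable : Differentiable ℂ eπ := by unfold eπ; fun_prop

lemma eπ_eq_one_iff (x : ℂ) : eπ (2 * x) = 1 ↔ ∃ n : ℤ, x = n := by
  rw [eπ, Complex.exp_eq_one_iff]
  refine exists_congr fun n => ?_
  have h : (2 * Real.pi * I : ℂ) ≠ 0 := Complex.two_pi_I_ne_zero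
  rw [show (Real.pi * I * (2 * x) : ℂ) = x * (2 * Real.pi * I) by ring]
  exact mul_left_inj' h

lemma norm_eπ_lt {x : ℂ} (h : 0 < x.im) : ‖eπ x‖ < 1 := by
  rw [eπ, Complex.norm_exp, Real.exp_lt_one_iff]
  simp
  positivity

lemma jTheta_eq (γ₁ γ₂ : ℝ) (u τ : ℂ) : jTheta γ₁ γ₂ u τ =
    eπ (γ₁ ^ 2 * τ + 2 * γ₁ * (u + γ₂)) * jacobiTheta₂ (u + γ₂ + γ₁ * τ) τ := by
  rw [jTheta, jacobiTheta₂, ← tsum_mul_left]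
  refine tsum_congr fun m => ?_
  rw [jacobiTheta₂_term, eπ, ← Complex.exp_add]
  ring_nf

/-- The odd theta function. -/
def tT (τ u : ℂ) : ℂ := jTheta (1/2) (1/2) u τ

lemma tT_eq (τ u : ℂ) : tT τ u =
    eπ (τ / 4 + u + 1 / 2) * jacobiTheta₂ (u + 1 / 2 + τ / 2) τ := by
  rw [tT, jTheta_eq]
  congr 2
  · push_cast; ring
  · push_cast; ring

lemma jTheta_shift (N : ℕ) (a b : ℕ) (u τ : ℂ) :
    jTheta (1/2 + a / N) (1/2 + b / N) u τ =
      eπ ((a / N) ^ 2 * τ + 2 * (a / N) * (u + 1 / 2 + b / N)) * tT τ (u + (a * τ + b) / N) := by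
  rw [jTheta_eq, tT_eq, ← mul_assoc, ← eπ_add]
  congr 2
  · push_cast; ring
  · push_cast; ring

lemma tT_differentiable {τ : ℂ} (hτ : 0 < τ.im) : Differentiable ℂ (tT τ) := by
  have : tT τ = fun u => eπ (τ / 4 + u + 1 / 2) * jacobiTheta₂ (u + 1 / 2 + τ / 2) τ :=
    funext fun u => tT_eq τ u
  rw [this]
  intro u
  refine DifferentiableAt.mul ?_ ?_
  · exact (eπ_differentiable _).comp u (by fun_prop)
  · exact (differentiableAt_jacobiTheta₂_fst (u + 1 / 2 + τ / 2) hτ).comp u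
      (f := fun u => u + 1 / 2 + τ / 2) (by fun_prop)

lemma tT_add_one (τ u : ℂ) : tT τ (u + 1) = - tT τ u := by
  rw [tT_eq, tT_eq, show u + 1 + 1 / 2 + τ / 2 = (u + 1 / 2 + τ / 2) + 1 by ring,
    jacobiTheta₂_add_left, show τ / 4 + (u + 1) + 1 / 2 = (τ / 4 + u + 1 / 2) + 1 by ring,
    eπ_add, eπ_one]
  ring

lemma tT_add_tau (τ u : ℂ) : tT τ (u + τ) = - eπ (-τ - 2 * u) * tT τ u := by
  rw [tT_eq, tT_eq, show u + τ + 1 / 2 + τ / 2 = (u + 1 / 2 + τ / 2) + τ by ring,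
    jacobiTheta₂_add_left',
    show cexp (-Real.pi * I * (τ + 2 * (u + 1 / 2 + τ / 2))) = eπ (-(τ + 2 * (u + 1 / 2 + τ / 2))) by
      rw [eπ]; ring_nf,
    show (-eπ (-τ - 2 * u)) = eπ (-τ - 2 * u + 1) by rw [eπ_add, eπ_one]; ring,
    ← mul_assoc, ← mul_assoc, ← eπ_add, ← eπ_add]
  congr 1
  rw [show τ / 4 + (u + τ) + 1 / 2 + -(τ + 2 * (u + 1 / 2 + τ / 2)) =
    -τ - 2 * u + 1 + (τ / 4 + u + 1 / 2) + 2 * (-1 : ℤ) by push_cast; ring, eπ_add, eπ_two_int, mul_one]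

lemma tT_neg (τ u : ℂ) : tT τ (-u) = - tT τ u := by
  rw [tT_eq, tT_eq, ← jacobiTheta₂_neg_left,
    show -(-u + 1 / 2 + τ / 2) = u - 1 / 2 - τ / 2 by ring,
    show u + 1 / 2 + τ / 2 = (u - 1 / 2 - τ / 2) + 1 + τ by ring,
    jacobiTheta₂_add_left', jacobiTheta₂_add_left,
    show cexp (-Real.pi * I * (τ + 2 * (u - 1 / 2 - τ / 2 + 1))) =
      eπ (-(τ + 2 * (u - 1 / 2 - τ / 2 + 1))) by rw [eπ]; ring_nf,
    ← mul_assoc, ← eπ_add, ← neg_mul]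
  congr 1
  rw [show τ / 4 + -u + 1 / 2 = (τ / 4 + u + 1 / 2 + -(τ + 2 * (u - 1 / 2 - τ / 2 + 1))) + 1 by ring,
    eπ_add _ 1, eπ_one]
  ring

lemma tT_zero (τ : ℂ) : tT τ 0 = 0 := by
  have := tT_neg τ 0
  rw [neg_zero] at this
  linear_combination this / 2

lemma tT_add_int_of_zero (τ u : ℂ) (n m : ℤ) : tT τ (u + n + m * τ) = 0 ↔ tT τ u = 0 := by
  have h1 : ∀ (n : ℤ) (v : ℂ), tT τ (v + n) = 0 ↔ tT τ v = 0 := by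
    intro n
    induction n using Int.induction_on with
    | zero => simp
    | succ k ih =>
      intro v
      push_cast at ih ⊢
      rw [← add_assoc, tT_add_one, neg_eq_zero, ih]
    | pred k ih =>
      intro v
      rw [← neg_eq_zero, ← tT_add_one, ← ih v]
      push_cast
      ring_nf
  have h2 : ∀ (n : ℤ) (v : ℂ), tT τ (v + n * τ) = 0 ↔ tT τ v = 0 := by
    have h3 : ∀ v, tT τ (v + τ) = 0 ↔ tT τ v = 0 := by
      intro v
      rw [tT_add_tau]
      simp [eπ_ne]
    intro n
    induction n using Int.induction_on with
    | zero => simp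
    | succ k ih =>
      intro v
      push_cast at ih ⊢
      rw [add_mul, one_mul, ← add_assoc, h3, ih]
    | pred k ih =>
      intro v
      rw [← h3, ← ih v]
      push_cast
      ring_nf
  rw [h2, h1]

open Filter Topology in
lemma exists_entire_ext (f : ℂ → ℂ)
    (h : ∀ u, ∃ g : ℂ → ℂ, AnalyticAt ℂ g u ∧ f =ᶠ[𝓝[≠] u] g) :
    ∃ F : ℂ → ℂ, Differentiable ℂ F ∧ ∀ u, f =ᶠ[𝓝[≠] u] F := by
  choose g hg hfg using h
  have lim : ∀ u, Tendsto f (𝓝[≠] u) (𝓝 (g u u)) := fun u =>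
    Tendsto.congr' (hfg u).symm ((hg u).continuousAt.tendsto.mono_left nhdsWithin_le_nhds)
  have key : ∀ u, (fun v => g v v) =ᶠ[𝓝 u] g u := by
    intro u
    have h1 : ∀ᶠ v in 𝓝[≠] u, ∀ᶠ w in 𝓝[≠] v, f w = g u w := by
      have := eventually_eventually_nhdsWithin.2 (hfg u)
      rw [eventually_nhdsWithin_iff] at this ⊢
      filter_upwards [this] with v hv hvu
      have h2 := hv hvu
      rw [isOpen_compl_singleton.nhdsWithin_eq hvu] at h2
      exact h2.filter_mono nhdsWithin_le_nhds
    have h2 := (hg u).eventually_analyticAt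
    rw [eventually_nhdsWithin_iff] at h1
    filter_upwards [h1, h2] with v hv hv2
    by_cases hvu : v = u
    · rw [hvu]
    · have l2 : Tendsto f (𝓝[≠] v) (𝓝 (g u v)) :=
        Tendsto.congr' (EventuallyEq.symm (hv hvu)) (hv2.continuousAt.tendsto.mono_left nhdsWithin_le_nhds)
      exact tendsto_nhds_unique (lim v) l2
  refine ⟨fun v => g v v, fun u => ?_, fun u => ?_⟩
  · exact ((hg u).congr (key u).symm).differentiableAt
  · exact (hfg u).trans ((key u).symm.filter_mono nhdsWithin_le_nhds)

open Filter Topology in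
lemma punct_unique {f g : ℂ → ℂ} (hf : Continuous f) (hg : Continuous g) (u : ℂ)
    (h : f =ᶠ[𝓝[≠] u] g) : f u = g u :=
  tendsto_nhds_unique (Tendsto.congr' h (hf.continuousAt.tendsto.mono_left nhdsWithin_le_nhds))
    (hg.continuousAt.tendsto.mono_left nhdsWithin_le_nhds)

open Filter Topology in
lemma tendsto_punct_add (u a : ℂ) : Tendsto (fun v => v + a) (𝓝[≠] u) (𝓝[≠] (u + a)) := by
  refine tendsto_nhdsWithin_iff.2 ⟨?_, ?_⟩
  · exact ((continuous_id.add continuous_const).tendsto u).mono_left nhdsWithin_le_nhds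
  · filter_upwards [self_mem_nhdsWithin] with v hv
    simpa using hv

lemma bdd_of_periodic (τ : ℂ) (hτ : 0 < τ.im) (G : ℂ → ℂ) (hG : Continuous G)
    (h1 : ∀ u, ‖G (u + 1)‖ = ‖G u‖) (h2 : ∀ u, ‖G (u + τ)‖ = ‖G u‖) :
    Bornology.IsBounded (Set.range G) := by
  have h1' : ∀ (n : ℤ) u, ‖G (u + n)‖ = ‖G u‖ := by
    intro n
    induction n using Int.induction_on with
    | zero => simp
    | succ k ih => intro u; push_cast at ih ⊢; rw [← add_assoc, h1, ih]
    | pred k ih => intro u; rw [← h1, ← ih u]; push_cast; ring_nf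
  have h2' : ∀ (n : ℤ) u, ‖G (u + n * τ)‖ = ‖G u‖ := by
    intro n
    induction n using Int.induction_on with
    | zero => simp
    | succ k ih => intro u; push_cast at ih ⊢; rw [add_mul, one_mul, ← add_assoc, h2, ih]
    | pred k ih => intro u; rw [← h2, ← ih u]; push_cast; ring_nf
  let φ : ℝ × ℝ → ℂ := fun s => G (s.1 + s.2 * τ)
  have hφ : Continuous φ := by fun_prop
  obtain ⟨C, hC⟩ := (isCompact_Icc (a := (0 : ℝ × ℝ)) (b := (1, 1))).exists_bound_of_continuousOn
    hφ.continuousOn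
  refine (Metric.isBounded_iff_subset_closedBall 0).2 ⟨C, ?_⟩
  rintro _ ⟨u, rfl⟩
  rw [mem_closedBall_zero_iff]
  set t : ℝ := u.im / τ.im with ht
  set s : ℝ := u.re - t * τ.re with hs
  have hu : u = s + t * τ := by
    apply Complex.ext
    · simp [hs]
    · simp [ht]; field_simp
  have h3 : u = ((Int.fract s : ℝ) + (Int.fract t : ℝ) * τ) + (⌊s⌋ : ℤ) + (⌊t⌋ : ℤ) * τ := by
    rw [hu]
    nth_rewrite 1 [← Int.fract_add_floor s, ← Int.fract_add_floor t]
    push_cast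
    ring
  rw [h3, h2', h1']
  exact hC (Int.fract s, Int.fract t) ⟨⟨Int.fract_nonneg _, Int.fract_nonneg _⟩,
    ⟨(Int.fract_lt_one _).le, (Int.fract_lt_one _).le⟩⟩

open Filter Topology in
lemma liouville_quasi (τ : ℂ) (hτ : 0 < τ.im) (f : ℂ → ℂ) (μ : ℂ) (hμ : μ ≠ 0)
    (h : ∀ u, ∃ g : ℂ → ℂ, AnalyticAt ℂ g u ∧ f =ᶠ[𝓝[≠] u] g)
    (h1 : ∀ u, f (u + 1) = f u) (h2 : ∀ u, f (u + τ) = μ * f u) :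
    ∃ C κ : ℂ, (∀ u, f =ᶠ[𝓝[≠] u] fun v => C * cexp (κ * v)) ∧
      (C = 0 ∨ (cexp κ = 1 ∧ cexp (κ * τ) = μ)) := by
  obtain ⟨F, hF, hfF⟩ := exists_entire_ext f h
  have F1 : ∀ u, F (u + 1) = F u := by
    intro u
    refine punct_unique (f := fun v => F (v + 1)) (hF.continuous.comp (by fun_prop)) hF.continuous u ?_
    filter_upwards [(tendsto_punct_add u 1).eventually (hfF (u + 1)), hfF u] with v hv hv'
    rw [← hv, ← hv', h1]
  have F2 : ∀ u, F (u + τ) = μ * F u := by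
    intro u
    refine punct_unique (f := fun v => F (v + τ)) (g := fun v => μ * F v)
      (hF.continuous.comp (by fun_prop)) (continuous_const.mul hF.continuous) u ?_
    filter_upwards [(tendsto_punct_add u τ).eventually (hfF (u + τ)), hfF u] with v hv hv'
    rw [← hv, ← hv', h2]
  set k : ℝ := Real.log ‖μ‖ / τ.im with hk
  let G : ℂ → ℂ := fun u => F u * cexp (I * k * u)
  have hG : Differentiable ℂ G := by fun_prop
  have hb : Bornology.IsBounded (Set.range G) := by
    refine bdd_of_periodic τ hτ G hG.continuous ?_ ?_
    · intro u
      simp only [G, norm_mul, F1, Complex.norm_exp]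
      simp
    · intro u
      simp only [G, norm_mul, F2, mul_add, Complex.exp_add]
      have : ‖cexp (I * k * τ)‖ = ‖μ‖⁻¹ := by
        rw [Complex.norm_exp]
        simp only [mul_re, I_re, ofReal_re, zero_mul, I_im, ofReal_im, mul_zero, sub_self, mul_im,
          one_mul, zero_add, zero_sub]
        rw [hk, div_mul_cancel₀ _ hτ.ne', Real.exp_neg, Real.exp_log (norm_pos_iff.2 hμ)]
      rw [this]
      have := norm_ne_zero_iff.2 hμ
      field_simp
  have hconst : ∀ u, F u = G 0 * cexp (-(I * k) * u) := by
    intro u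
    have := hG.apply_eq_apply_of_bounded hb u 0
    rw [← this]
    simp only [G]
    rw [mul_assoc, ← Complex.exp_add]
    ring_nf
    simp
  refine ⟨G 0, -(I * k), fun u => ?_, ?_⟩
  · filter_upwards [hfF u] with v hv
    rw [hv, hconst]
  · by_cases hC : G 0 = 0
    · exact Or.inl hC
    · right
      have e1 := F1 0
      have e2 := F2 0
      rw [zero_add, hconst, hconst 0] at e1 e2
      simp only [mul_one, mul_zero, Complex.exp_zero] at e1 e2
      constructor
      · exact mul_left_cancel₀ hC (by rw [e1, mul_one])
      · exact mul_left_cancel₀ hC (by rw [e2]; ring)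

lemma summable_poch1 {s : ℂ} (hs : ‖s‖ < 1) (x : ℂ) : Summable fun n : ℕ => ‖-(x * s ^ n)‖ := by
  simp only [norm_neg, norm_mul, norm_pow]
  exact (summable_geometric_of_lt_one (norm_nonneg _) hs).mul_left _

lemma multipliable_poch1 {s : ℂ} (hs : ‖s‖ < 1) (x : ℂ) :
    Multipliable fun n : ℕ => (1 - x * s ^ n) := by
  simp only [sub_eq_add_neg]
  exact multipliable_one_add_of_summable (summable_poch1 hs x)

lemma poch1_step {s : ℂ} (hs : ‖s‖ < 1) (x : ℂ) : poch1 x s = (1 - x) * poch1 (x * s) s := by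
  rw [poch1, tprod_eq_zero_mul' (by
    simpa only [pow_succ', mul_assoc] using multipliable_poch1 hs (x * s)), poch1]
  simp only [pow_zero, mul_one, pow_succ', mul_assoc]

lemma poch1_ne_zero {s : ℂ} (hs : ‖s‖ < 1) (x : ℂ) (h : ∀ n : ℕ, 1 - x * s ^ n ≠ 0) :
    poch1 x s ≠ 0 := by
  rw [poch1]
  simp only [sub_eq_add_neg] at h ⊢
  exact tprod_one_add_ne_zero_of_summable h (summable_poch1 hs x)

lemma poch1_differentiable {s : ℂ} (hs : ‖s‖ < 1) : Differentiable ℂ fun x => poch1 x s := by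
  intro x
  have hx : Metric.ball (0 : ℂ) (‖x‖ + 1) ∈ nhds x :=
    Metric.isOpen_ball.mem_nhds (by simp)
  have hsum : Summable fun n : ℕ => (‖x‖ + 1) * ‖s‖ ^ n :=
    (summable_geometric_of_lt_one (norm_nonneg _) hs).mul_left _
  have := hsum.hasProdLocallyUniformlyOn_nat_one_add (f := fun (n : ℕ) (y : ℂ) => -(y * s ^ n))
    (K := Metric.ball (0 : ℂ) (‖x‖ + 1)) Metric.isOpen_ball
    (Filter.Eventually.of_forall fun n y hy => by
      rw [norm_neg, norm_mul, norm_pow]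
      gcongr
      exact (mem_ball_zero_iff.1 hy).le) (fun n => by fun_prop)
  have h2 : DifferentiableOn ℂ (fun x => ∏' i : ℕ, (1 + -(x * s ^ i)))
      (Metric.ball (0 : ℂ) (‖x‖ + 1)) := by
    refine this.differentiableOn (.of_forall fun S => ?_) Metric.isOpen_ball
    simpa [Finset.prod_fn] using
      DifferentiableOn.finsetProd (fun (_ : ℕ) _ ↦ by fun_prop)
  have h3 := h2.differentiableAt hx
  simpa only [poch1, sub_eq_add_neg] using h3

lemma multipliable_poch2 {p s : ℂ} (hp : ‖p‖ < 1) (hs : ‖s‖ < 1) (x : ℂ) :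
    Multipliable fun n : ℕ × ℕ => (1 - x * p ^ n.1 * s ^ n.2) := by
  simp only [sub_eq_add_neg]
  refine multipliable_one_add_of_summable ?_
  simp only [norm_neg, norm_mul, norm_pow, mul_assoc]
  refine Summable.mul_left _ ?_
  exact (summable_geometric_of_lt_one (norm_nonneg _) hp).mul_of_nonneg
    (summable_geometric_of_lt_one (norm_nonneg _) hs) (fun _ => by positivity)
    (fun _ => by positivity)

/-- splitting off the zeroth row. -/
def rowEquiv : ℕ ⊕ (ℕ × ℕ) ≃ ℕ × ℕ where
  toFun := Sum.elim (fun i => (i, 0)) (fun n => (n.1, n.2 + 1))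
  invFun := fun n => match n with
    | (i, 0) => Sum.inl i
    | (i, j + 1) => Sum.inr (i, j)
  left_inv := by rintro (i | ⟨i, j⟩) <;> rfl
  right_inv := by rintro ⟨i, (_ | j)⟩ <;> rfl

lemma poch2_step {p s : ℂ} (hp : ‖p‖ < 1) (hs : ‖s‖ < 1) (x : ℂ) :
    poch2 x p s = poch1 x p * poch2 (x * s) p s := by
  have h1 := (multipliable_poch1 hp x).hasProd
  have h2 := (multipliable_poch2 hp hs (x * s)).hasProd
  have h3 : HasProd ((fun n : ℕ × ℕ => (1 - x * p ^ n.1 * s ^ n.2)) ∘ rowEquiv)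
      (poch1 x p * poch2 (x * s) p s) := by
    refine HasProd.sum ?_ ?_
    · have e : ((fun n : ℕ × ℕ => (1 - x * p ^ n.1 * s ^ n.2)) ∘ rowEquiv) ∘ Sum.inl =
          fun n : ℕ => (1 - x * p ^ n) := by
        funext n; simp [rowEquiv]
      rw [e]; exact h1
    · have e : ((fun n : ℕ × ℕ => (1 - x * p ^ n.1 * s ^ n.2)) ∘ rowEquiv) ∘ Sum.inr =
          fun n : ℕ × ℕ => (1 - x * s * p ^ n.1 * s ^ n.2) := by
        funext n; simp only [rowEquiv, Function.comp, Equiv.coe_fn_mk, Sum.elim_inr]; ring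
      rw [e]; exact h2
  exact (rowEquiv.hasProd_iff.1 h3).tprod_eq

/-- product form of the odd theta function. -/
def tB (τ u : ℂ) : ℂ :=
  eπ (-u) * poch1 (eπ (2 * u)) (eπ (2 * τ)) * poch1 (eπ (2 * τ) * eπ (-2 * u)) (eπ (2 * τ))

lemma norm_p {τ : ℂ} (hτ : 0 < τ.im) : ‖eπ (2 * τ)‖ < 1 := norm_eπ_lt (by simpa using hτ)

lemma tB_differentiable {τ : ℂ} (hτ : 0 < τ.im) : Differentiable ℂ (tB τ) := by
  have h := poch1_differentiable (norm_p hτ)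
  intro u
  refine DifferentiableAt.mul (DifferentiableAt.mul ?_ ?_) ?_
  · exact (eπ_differentiable _).comp u (by fun_prop)
  · exact (h _).comp u ((eπ_differentiable _).comp u (by fun_prop))
  · exact (h _).comp u (((eπ_differentiable _).comp u (by fun_prop)).const_mul _)

lemma tB_split {τ : ℂ} (hτ : 0 < τ.im) (u : ℂ) : tB τ u =
    (1 - eπ (2 * u)) * (eπ (-u) * poch1 (eπ (2 * u) * eπ (2 * τ)) (eπ (2 * τ)) *
      poch1 (eπ (2 * τ) * eπ (-2 * u)) (eπ (2 * τ))) := by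
  rw [tB, poch1_step (norm_p hτ)]
  ring

lemma tB_add_one (τ u : ℂ) : tB τ (u + 1) = - tB τ u := by
  rw [tB, tB, show -(u + 1) = -u + 1 + 2 * (-1 : ℤ) by push_cast; ring,
    show 2 * (u + 1) = 2 * u + 2 * (1 : ℤ) by push_cast; ring,
    show -2 * (u + 1) = -2 * u + 2 * (-1 : ℤ) by push_cast; ring]
  simp only [eπ_add, eπ_two_int, eπ_one]
  ring

lemma tB_add_tau {τ : ℂ} (hτ : 0 < τ.im) (u : ℂ) :
    tB τ (u + τ) = - eπ (-τ - 2 * u) * tB τ u := by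
  rw [tB_split hτ u, tB, mul_add, eπ_add (2 * u),
    show eπ (2 * τ) * eπ (-2 * (u + τ)) = eπ (-2 * u) by rw [← eπ_add]; ring_nf,
    poch1_step (norm_p hτ) (eπ (-2 * u)), mul_comm (eπ (-2 * u)) (eπ (2 * τ)),
    show -(u + τ) = -u + -τ by ring, eπ_add, sub_eq_add_neg (-τ), eπ_add (-τ),
    show -(2 * u) = -2 * u by ring]
  have : eπ (-2 * u) * eπ (2 * u) = 1 := by rw [← eπ_add, ← eπ_zero]; ring_nf
  linear_combination (- eπ (-u) * eπ (-τ) * poch1 (eπ (2 * u) * eπ (2 * τ)) (eπ (2 * τ)) *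
    poch1 (eπ (2 * τ) * eπ (-2 * u)) (eπ (2 * τ))) * this

lemma tB_eq_zero {τ : ℂ} (hτ : 0 < τ.im) (u : ℂ) (h : tB τ u = 0) :
    ∃ n m : ℤ, u = n + m * τ := by
  by_contra hcon
  push Not at hcon
  refine mul_ne_zero (mul_ne_zero (eπ_ne _) ?_) ?_ h
  · refine poch1_ne_zero (norm_p hτ) _ fun n hn => ?_
    rw [eπ_pow, ← eπ_add, sub_eq_zero, show 2 * u + n * (2 * τ) = 2 * (u + n * τ) by ring] at hn
    obtain ⟨k, hk⟩ := (eπ_eq_one_iff _).1 hn.symm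
    refine hcon k (-n) ?_
    push_cast
    linear_combination hk
  · refine poch1_ne_zero (norm_p hτ) _ fun n hn => ?_
    rw [eπ_pow, ← eπ_add, ← eπ_add, sub_eq_zero,
      show 2 * τ + -2 * u + n * (2 * τ) = 2 * ((n + 1) * τ - u) by ring] at hn
    obtain ⟨k, hk⟩ := (eπ_eq_one_iff _).1 hn.symm
    refine hcon (-k) (n + 1) ?_
    push_cast
    linear_combination -hk

lemma tB_zero {τ : ℂ} (hτ : 0 < τ.im) : tB τ 0 = 0 := by
  rw [tB_split hτ]; simp [eπ_zero]

lemma tB_deriv_ne {τ : ℂ} (hτ : 0 < τ.im) : deriv (tB τ) 0 ≠ 0 := by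
  have h0 : poch1 (eπ (2 * τ)) (eπ (2 * τ)) ≠ 0 := by
    refine poch1_ne_zero (norm_p hτ) _ fun n hn => ?_
    have h1 : ‖eπ (2 * τ) ^ (n + 1)‖ < 1 := by
      rw [norm_pow]; exact pow_lt_one₀ (norm_nonneg _) (norm_p hτ) (by simp)
    rw [← pow_succ', sub_eq_zero] at hn
    rw [← hn] at h1
    simp at h1
  let R : ℂ → ℂ := fun u => (eπ (-u) * poch1 (eπ (2 * u) * eπ (2 * τ)) (eπ (2 * τ)) *
      poch1 (eπ (2 * τ) * eπ (-2 * u)) (eπ (2 * τ)))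
  have hR : DifferentiableAt ℂ R 0 := by
    have h := poch1_differentiable (norm_p hτ)
    refine DifferentiableAt.mul (DifferentiableAt.mul ?_ ?_) ?_
    · exact (eπ_differentiable _).comp 0 (by fun_prop)
    · exact (h _).comp 0 (((eπ_differentiable _).comp 0 (by fun_prop)).mul_const _)
    · exact (h _).comp 0 (((eπ_differentiable _).comp 0 (by fun_prop)).const_mul _)
  have h1 : HasDerivAt (fun u : ℂ => 1 - eπ (2 * u)) (-(Real.pi * I * 2)) 0 := by
    have : HasDerivAt (fun u : ℂ => 1 - cexp (Real.pi * I * (2 * u)))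
        (-(cexp (Real.pi * I * (2 * 0)) * (Real.pi * I * (2 * 1)))) 0 :=
      ((((hasDerivAt_id (0 : ℂ)).const_mul 2).const_mul (Real.pi * I : ℂ)).cexp).const_sub 1
    simpa [eπ] using this
  have h2 := h1.mul hR.hasDerivAt
  have h3 : tB τ = (fun u : ℂ => 1 - eπ (2 * u)) * R := funext fun u => tB_split hτ u
  rw [h3, h2.deriv]
  simp [R, eπ_zero, h0, Real.pi_ne_zero]

lemma analyticAt_dslope {f : ℂ → ℂ} {z : ℂ} (h : AnalyticAt ℂ f z) :
    AnalyticAt ℂ (dslope f z) z := by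
  obtain ⟨p, hp⟩ := h
  exact hp.has_fpower_series_dslope_fslope.analyticAt

lemma eq_mul_dslope {f : ℂ → ℂ} (h : f 0 = 0) (u : ℂ) : f u = u * dslope f 0 u := by
  have := sub_smul_dslope f 0 u
  rw [h, sub_zero, sub_zero, smul_eq_mul] at this
  exact this.symm

open Filter Topology in
lemma transport_ext (f : ℂ → ℂ) (τ μ : ℂ) (hμ : μ ≠ 0)
    (h1 : ∀ u, f (u + 1) = f u) (h2 : ∀ u, f (u + τ) = μ * f u)
    (h0 : ∃ g : ℂ → ℂ, AnalyticAt ℂ g 0 ∧ f =ᶠ[𝓝[≠] 0] g) (n m : ℤ) :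
    ∃ g : ℂ → ℂ, AnalyticAt ℂ g (n + m * τ) ∧ f =ᶠ[𝓝[≠] (n + m * τ)] g := by
  have h1' : ∀ (n : ℤ) u, f (u + n) = f u := by
    intro n
    induction n using Int.induction_on with
    | zero => simp
    | succ k ih => intro u; push_cast at ih ⊢; rw [← add_assoc, h1, ih]
    | pred k ih => intro u; rw [← h1, ← ih u]; push_cast; ring_nf
  have h2' : ∀ (n : ℤ) u, f (u + n * τ) = μ ^ n * f u := by
    intro n
    induction n using Int.induction_on with
    | zero => simp
    | succ k ih =>
      intro u
      have := ih u
      push_cast at this ⊢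
      rw [add_mul, one_mul, ← add_assoc, h2, this, zpow_add_one₀ hμ]
      ring
    | pred k ih =>
      intro u
      have := ih u
      have h3 := h2 (u + ((-(k : ℤ) - 1 : ℤ) : ℂ) * τ)
      rw [show u + ((-(k : ℤ) - 1 : ℤ) : ℂ) * τ + τ = u + ((-(k : ℤ) : ℤ) : ℂ) * τ by
        push_cast; ring, this] at h3
      rw [zpow_sub_one₀ hμ]
      field_simp
      linear_combination -h3
  obtain ⟨g, hg, hfg⟩ := h0
  refine ⟨fun v => μ ^ m * g (v - (n + m * τ)), ?_, ?_⟩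
  · refine analyticAt_const.mul (AnalyticAt.fun_comp (g := g) (by simpa using hg) (by fun_prop))
  · have := (tendsto_punct_add (n + m * τ) (-(n + m * τ)))
    rw [add_neg_cancel] at this
    filter_upwards [this.eventually hfg] with v hv
    rw [sub_eq_add_neg, ← hv, ← h2', ← h1' n (_ + m * τ)]
    ring_nf

open Filter Topology in
lemma tT_eq_tB {τ : ℂ} (hτ : 0 < τ.im) : ∃ C : ℂ, ∀ u, tT τ u = C * tB τ u := by
  have hTd := tT_differentiable hτ
  have hBd := tB_differentiable hτ
  have Tan : ∀ u, AnalyticAt ℂ (tT τ) u := fun u => hTd.analyticAt u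
  have Ban : ∀ u, AnalyticAt ℂ (tB τ) u := fun u => hBd.analyticAt u
  let f : ℂ → ℂ := fun u => tT τ u / tB τ u
  have h1 : ∀ u, f (u + 1) = f u := by
    intro u; simp only [f, tT_add_one, tB_add_one, neg_div_neg_eq]
  have h2 : ∀ u, f (u + τ) = 1 * f u := by
    intro u
    simp only [f, tT_add_tau, tB_add_tau hτ, one_mul]
    rw [mul_div_mul_left]
    exact neg_ne_zero.2 (eπ_ne _)
  have h0 : ∃ g : ℂ → ℂ, AnalyticAt ℂ g 0 ∧ f =ᶠ[𝓝[≠] 0] g := by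
    refine ⟨fun u => dslope (tT τ) 0 u / dslope (tB τ) 0 u, ?_, ?_⟩
    · refine (analyticAt_dslope (Tan 0)).div (analyticAt_dslope (Ban 0)) ?_
      rw [dslope_same]
      exact tB_deriv_ne hτ
    · filter_upwards [self_mem_nhdsWithin] with v hv
      simp only [f]
      rw [eq_mul_dslope (tT_zero τ) v, eq_mul_dslope (tB_zero hτ) v, mul_div_mul_left _ _ hv]
  obtain ⟨C, κ, hC, hκ⟩ := liouville_quasi τ hτ f 1 one_ne_zero (by
    intro u
    by_cases hu : tB τ u = 0
    · obtain ⟨n, m, rfl⟩ := tB_eq_zero hτ u hu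
      exact transport_ext f τ 1 one_ne_zero h1 h2 h0 n m
    · exact ⟨f, (Tan u).div (Ban u) hu, EventuallyEq.rfl⟩) h1 h2
  have hC' : ∀ v, C * cexp (κ * v) = C := by
    intro v
    rcases hκ with h | ⟨h, h'⟩
    · simp [h]
    · rw [Complex.exp_eq_one_iff] at h h'
      obtain ⟨m, hm⟩ := h
      obtain ⟨n, hn⟩ := h'
      rw [hm] at hn
      have h3 : (m : ℂ) * τ = n := by
        apply mul_right_cancel₀ Complex.two_pi_I_ne_zero
        linear_combination hn
      have h4 := congrArg Complex.im h3
      simp at h4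
      have h5 : m = 0 := by
        rcases h4 with h | h
        · exact h
        · exact absurd h hτ.ne'
      simp [hm, h5]
  refine ⟨C, fun u => ?_⟩
  refine punct_unique (f := tT τ) (g := fun u => C * tB τ u) hTd.continuous
    (continuous_const.mul hBd.continuous) u ?_
  have hB : ∀ᶠ v in 𝓝[≠] u, tB τ v ≠ 0 := by
    rcases (Ban u).eventually_eq_zero_or_eventually_ne_zero with h | h
    · have h3 := AnalyticOnNhd.eqOn_zero_of_preconnected_of_eventuallyEq_zero
        (fun u _ => Ban u : AnalyticOnNhd ℂ (tB τ) Set.univ)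
        isPreconnected_univ (Set.mem_univ u) h
      have h4 : tB τ = 0 := funext fun v => h3 (Set.mem_univ v)
      exact absurd (by rw [h4]; simp) (tB_deriv_ne hτ)
    · exact h
  filter_upwards [hC u, hB] with v hv hv2
  rw [hC' v] at hv
  rw [← hv]
  simp only [f]
  field_simp

/-- All consequences of the product formula, packaged. -/
lemma tT_facts {τ : ℂ} (hτ : 0 < τ.im) (w : ℂ) (hw : tT τ w ≠ 0) :
    ∃ C : ℂ, C ≠ 0 ∧ (∀ u, tT τ u = C * tB τ u) := by
  obtain ⟨C, hC⟩ := tT_eq_tB hτ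
  refine ⟨C, ?_, hC⟩
  rintro rfl
  exact hw (by rw [hC]; simp)

lemma tT_eq_zero_iff {τ : ℂ} (hτ : 0 < τ.im) (w : ℂ) (hw : tT τ w ≠ 0) (u : ℂ) :
    tT τ u = 0 ↔ ∃ n m : ℤ, u = n + m * τ := by
  obtain ⟨C, hC, h⟩ := tT_facts hτ w hw
  constructor
  · intro hu
    rw [h] at hu
    exact tB_eq_zero hτ u ((mul_eq_zero.1 hu).resolve_left hC)
  · rintro ⟨n, m, rfl⟩
    have := (tT_add_int_of_zero τ 0 n m).2 (tT_zero τ)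
    rwa [zero_add] at this

lemma tT_deriv_ne {τ : ℂ} (hτ : 0 < τ.im) (w : ℂ) (hw : tT τ w ≠ 0) : deriv (tT τ) 0 ≠ 0 := by
  obtain ⟨C, hC, h⟩ := tT_facts hτ w hw
  rw [show tT τ = fun u => C * tB τ u from funext h, deriv_const_mul _ (tB_differentiable hτ 0)]
  exact mul_ne_zero hC (tB_deriv_ne hτ)

open Filter Topology in
lemma tT_eventually_ne {τ : ℂ} (hτ : 0 < τ.im) (w : ℂ) (hw : tT τ w ≠ 0) (u : ℂ) :
    ∀ᶠ v in 𝓝[≠] u, tT τ v ≠ 0 := by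
  have Tan : ∀ u, AnalyticAt ℂ (tT τ) u := fun u => (tT_differentiable hτ).analyticAt u
  rcases (Tan u).eventually_eq_zero_or_eventually_ne_zero with h | h
  · have h3 := AnalyticOnNhd.eqOn_zero_of_preconnected_of_eventuallyEq_zero
        (fun u _ => Tan u : AnalyticOnNhd ℂ (tT τ) Set.univ)
      isPreconnected_univ (Set.mem_univ u) h
    exact absurd (h3 (Set.mem_univ w)) hw
  · exact h

lemma eπ_congr_int {x y : ℂ} (n : ℤ) (h : x = y + 2 * n) : eπ x = eπ y := by
  rw [h, eπ_add, eπ_two_int, mul_one]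

/-- splitting pairs by parity of the difference. -/
def parFun : (ℤ × ℤ) ⊕ (ℤ × ℤ) → ℤ × ℤ :=
  Sum.elim (fun k => (k.1 + k.2, k.1 - k.2 - 1)) (fun k => (k.1 + k.2, k.1 - k.2))

lemma parFun_bij : Function.Bijective parFun := by
  constructor
  · rintro (⟨k, l⟩ | ⟨k, l⟩) (⟨m, n⟩ | ⟨m, n⟩) h <;>
      simp only [parFun, Sum.elim_inl, Sum.elim_inr, Prod.mk.injEq] at h
    · have h1 : k = m := by omega
      have h2 : l = n := by omega
      rw [h1, h2]
    · omega
    · omega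
    · have h1 : k = m := by omega
      have h2 : l = n := by omega
      rw [h1, h2]
  · rintro ⟨m, n⟩
    by_cases h : (m - n) % 2 = 0
    · refine ⟨Sum.inr (m - (m - n) / 2, (m - n) / 2), ?_⟩
      simp only [parFun, Sum.elim_inr, Prod.mk.injEq]
      omega
    · refine ⟨Sum.inl (m - (m - n) / 2, (m - n) / 2), ?_⟩
      simp only [parFun, Sum.elim_inl, Prod.mk.injEq]
      omega

/-- the bijection as an equivalence. -/
def parEquiv : (ℤ × ℤ) ⊕ (ℤ × ℤ) ≃ ℤ × ℤ := Equiv.ofBijective parFun parFun_bij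

lemma parEquiv_inl (k : ℤ × ℤ) : parEquiv (Sum.inl k) = (k.1 + k.2, k.1 - k.2 - 1) := rfl
lemma parEquiv_inr (k : ℤ × ℤ) : parEquiv (Sum.inr k) = (k.1 + k.2, k.1 - k.2) := rfl

/-- term of the odd theta function. -/
def tTerm (τ : ℂ) (m : ℤ) (u : ℂ) : ℂ :=
  eπ (((m : ℂ) + 1 / 2) ^ 2 * τ + 2 * ((m : ℂ) + 1 / 2) * (u + 1 / 2))
/-- even level-two term. -/
def evTerm (τ : ℂ) (k : ℤ) (x : ℂ) : ℂ := eπ (2 * (k : ℂ) ^ 2 * τ + 4 * k * x)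
/-- odd level-two term. -/
def odTerm (τ : ℂ) (k : ℤ) (x : ℂ) : ℂ :=
  eπ ((2 * (k : ℂ) + 1) ^ 2 / 2 * τ + 2 * (2 * k + 1) * x)

lemma summable_tTerm {τ : ℂ} (hτ : 0 < τ.im) (u : ℂ) : Summable fun m => ‖tTerm τ m u‖ := by
  have h := ((summable_jacobiTheta₂_term_iff (u + 1 / 2 + τ / 2) τ).2 hτ).mul_left
    (eπ (τ / 4 + u + 1 / 2))
  refine Summable.norm (h.congr fun m => ?_)
  rw [tTerm, jacobiTheta₂_term, eπ, eπ, ← Complex.exp_add]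
  ring_nf

lemma summable_evTerm {τ : ℂ} (hτ : 0 < τ.im) (u : ℂ) : Summable fun m => ‖evTerm τ m u‖ := by
  have h := ((summable_jacobiTheta₂_term_iff (2 * u) (2 * τ)).2 (by simpa using hτ))
  refine Summable.norm (h.congr fun m => ?_)
  rw [evTerm, jacobiTheta₂_term, eπ]
  ring_nf

lemma summable_odTerm {τ : ℂ} (hτ : 0 < τ.im) (u : ℂ) : Summable fun m => ‖odTerm τ m u‖ := by
  have h := ((summable_jacobiTheta₂_term_iff (2 * u + τ) (2 * τ)).2 (by simpa using hτ)).mul_left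
    (eπ (τ / 2 + 2 * u))
  refine Summable.norm (h.congr fun m => ?_)
  rw [odTerm, jacobiTheta₂_term, eπ, eπ, ← Complex.exp_add]
  ring_nf

lemma tT_tsum (τ u : ℂ) : tT τ u = ∑' m, tTerm τ m u := by
  rw [tT, jTheta]
  refine tsum_congr fun m => ?_
  rw [tTerm, eπ]
  push_cast
  ring_nf

lemma tT_mul {τ : ℂ} (hτ : 0 < τ.im) (x y : ℂ) : tT τ (x + y) * tT τ (x - y) =
    (∑' k, evTerm τ k x) * (∑' k, odTerm τ k y) - (∑' k, odTerm τ k x) * (∑' k, evTerm τ k y) := by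
  rw [tT_tsum, tT_tsum, tsum_mul_tsum_of_summable_norm (summable_tTerm hτ _) (summable_tTerm hτ _),
    tsum_mul_tsum_of_summable_norm (summable_evTerm hτ _) (summable_odTerm hτ _),
    tsum_mul_tsum_of_summable_norm (summable_odTerm hτ _) (summable_evTerm hτ _),
    ← parEquiv.tsum_eq]
  have hs : Summable fun c => tTerm τ (parEquiv c).1 (x + y) * tTerm τ (parEquiv c).2 (x - y) :=
    parEquiv.summable_iff.2
      (summable_mul_of_summable_norm (summable_tTerm hτ (x + y)) (summable_tTerm hτ (x - y)))
  rw [Summable.tsum_sum (hs.comp_injective Sum.inl_injective)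
    (hs.comp_injective Sum.inr_injective)]
  have e1 : ∑' k : ℤ × ℤ, tTerm τ (parEquiv (Sum.inl k)).1 (x + y) *
      tTerm τ (parEquiv (Sum.inl k)).2 (x - y) = ∑' k : ℤ × ℤ, evTerm τ k.1 x * odTerm τ k.2 y := by
    refine tsum_congr fun k => ?_
    simp only [parEquiv_inl, tTerm, evTerm, odTerm]
    rw [← eπ_add, ← eπ_add]
    refine eπ_congr_int k.1 ?_
    push_cast
    ring
  have e2 : ∑' k : ℤ × ℤ, tTerm τ (parEquiv (Sum.inr k)).1 (x + y) *
      tTerm τ (parEquiv (Sum.inr k)).2 (x - y) =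
      -∑' k : ℤ × ℤ, odTerm τ k.1 x * evTerm τ k.2 y := by
    rw [← tsum_neg]
    refine tsum_congr fun k => ?_
    simp only [parEquiv_inr, tTerm, evTerm, odTerm]
    rw [← eπ_add, ← eπ_add, neg_eq_neg_one_mul, ← eπ_one, ← eπ_add]
    refine eπ_congr_int k.1 ?_
    push_cast
    ring
  rw [e1, e2]
  ring

lemma tT_weier {τ : ℂ} (hτ : 0 < τ.im) (a b c d : ℂ) :
    tT τ (a + b) * tT τ (a - b) * (tT τ (c + d) * tT τ (c - d)) -
    tT τ (a + c) * tT τ (a - c) * (tT τ (b + d) * tT τ (b - d)) +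
    tT τ (a + d) * tT τ (a - d) * (tT τ (b + c) * tT τ (b - c)) = 0 := by
  simp only [tT_mul hτ]
  ring

/-- the Fay-type three-term identity. -/
lemma tT_fay {τ : ℂ} (hτ : 0 < τ.im) (x y x' y' : ℂ) :
    tT τ (x + y) * tT τ (x' + y') * tT τ (y - y') * tT τ (x + x') =
      tT τ (x + (y - y')) * tT τ (x + x' + y') * tT τ x' * tT τ y -
      tT τ (x' - (y - y')) * tT τ (x + x' + y) * tT τ x * tT τ y' := by
  have h := tT_weier hτ ((x + y + x' + y') / 2) ((x + y - x' - y') / 2) ((x + x' + y - y') / 2)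
    ((x + x' - y + y') / 2)
  have n1 := tT_neg τ (x' - (y - y'))
  have n2 := tT_neg τ x'
  rw [show (x + y + x' + y') / 2 + (x + y - x' - y') / 2 = x + y by ring,
    show (x + y + x' + y') / 2 - (x + y - x' - y') / 2 = x' + y' by ring,
    show (x + x' + y - y') / 2 + (x + x' - y + y') / 2 = x + x' by ring,
    show (x + x' + y - y') / 2 - (x + x' - y + y') / 2 = y - y' by ring,
    show (x + y + x' + y') / 2 + (x + x' + y - y') / 2 = x + x' + y by ring,
    show (x + y + x' + y') / 2 - (x + x' + y - y') / 2 = y' by ring,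
    show (x + y - x' - y') / 2 + (x + x' - y + y') / 2 = x by ring,
    show (x + y - x' - y') / 2 - (x + x' - y + y') / 2 = -(x' - (y - y')) by ring,
    show (x + y + x' + y') / 2 + (x + x' - y + y') / 2 = x + x' + y' by ring,
    show (x + y + x' + y') / 2 - (x + x' - y + y') / 2 = y by ring,
    show (x + y - x' - y') / 2 + (x + x' + y - y') / 2 = x + (y - y') by ring,
    show (x + y - x' - y') / 2 - (x + x' + y - y') / 2 = -x' by ring, n1, n2] at h
  linear_combination h

/-- the normalised weights, extended to integer indices. -/
def wF (N : ℕ) (τ : ℂ) (a b : ℤ) (x y : ℂ) : ℂ :=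
  eπ (2 * ((a : ℂ) / N) * x) * (tT τ (x + (y + (a * τ + b) / N)) / tT τ (y + (a * τ + b) / N))

lemma wF_add_left {N : ℕ} (hN : N ≠ 0) (τ : ℂ) (a b : ℤ) (x y : ℂ) :
    wF N τ (a + N) b x y = wF N τ a b x y := by
  have hN' : (N : ℂ) ≠ 0 := by exact_mod_cast hN
  unfold wF
  push_cast
  rw [show y + (((a : ℂ) + N) * τ + b) / N = y + (a * τ + b) / N + τ by field_simp; ring]
  set v := y + ((a : ℂ) * τ + b) / N
  rw [← add_assoc, tT_add_tau, tT_add_tau]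
  rw [show 2 * (((a : ℂ) + N) / N) * x = 2 * ((a : ℂ) / N) * x + 2 * x by field_simp, eπ_add,
    show -τ - 2 * (x + v) = (-τ - 2 * v) + -(2 * x) by ring, eπ_add, eπ_neg]
  have h1 := eπ_ne (2 * x)
  have h2 := eπ_ne (-τ - 2 * v)
  rw [neg_mul, neg_mul, neg_div_neg_eq]
  rw [show eπ (-τ - 2 * v) * (eπ (2 * x))⁻¹ * tT τ (x + v) = eπ (-τ - 2 * v) *
    ((eπ (2 * x))⁻¹ * tT τ (x + v)) by ring, mul_div_mul_left _ _ h2]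
  field_simp

lemma wF_add_right {N : ℕ} (hN : N ≠ 0) (τ : ℂ) (a b : ℤ) (x y : ℂ) :
    wF N τ a (b + N) x y = wF N τ a b x y := by
  have hN' : (N : ℂ) ≠ 0 := by exact_mod_cast hN
  unfold wF
  push_cast
  rw [show y + ((a : ℂ) * τ + (b + N)) / N = y + (a * τ + b) / N + 1 by field_simp; ring]
  rw [← add_assoc, tT_add_one, tT_add_one, neg_div_neg_eq]

lemma wF_shift_one {N : ℕ} (τ : ℂ) (a b : ℤ) (x y : ℂ) :
    wF N τ a b x (y + 1 / N) = wF N τ a (b + 1) x y := by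
  unfold wF
  push_cast
  rw [show y + 1 / (N : ℂ) + (a * τ + b) / N = y + (a * τ + (b + 1)) / N by ring]

lemma wF_shift_tau {N : ℕ} (τ : ℂ) (a b : ℤ) (x y : ℂ) :
    wF N τ a b x (y + τ / N) = eπ (-2 * (x / N)) * wF N τ (a + 1) b x y := by
  unfold wF
  push_cast
  rw [show y + τ / (N : ℂ) + (a * τ + b) / N = y + ((a + 1) * τ + b) / N by ring,
    show 2 * (((a : ℂ) + 1) / N) * x = 2 * (a / N) * x + -(-2 * (x / N)) by ring, eπ_add, eπ_neg]
  have h1 := eπ_ne (-2 * (x / N))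
  generalize eπ (-2 * (x / N)) = E at h1 ⊢
  field_simp

lemma sum_periodic_one {M : Type*} [AddCommMonoid M] (N : ℕ) (F : ℤ → M)
    (hF : ∀ b, F (b + N) = F b) :
    ∑ b ∈ Finset.range N, F ((b : ℤ) + 1) = ∑ b ∈ Finset.range N, F b := by
  rcases N with _ | N
  · simp
  · rw [Finset.sum_range_succ, Finset.sum_range_succ']
    congr 1
    have := hF 0
    rw [zero_add] at this
    push_cast at this ⊢
    exact this

lemma sum_periodic {M : Type*} [AddCommMonoid M] (N : ℕ) (F : ℤ → M)
    (hF : ∀ b, F (b + N) = F b) (k : ℤ) :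
    ∑ b ∈ Finset.range N, F ((b : ℤ) + k) = ∑ b ∈ Finset.range N, F b := by
  have key : ∀ k : ℤ, ∑ b ∈ Finset.range N, F ((b : ℤ) + (k + 1)) =
      ∑ b ∈ Finset.range N, F ((b : ℤ) + k) := by
    intro k
    have := sum_periodic_one N (fun b => F (b + k))
      (fun b => by rw [add_right_comm]; exact hF _)
    rw [← this]
    refine Finset.sum_congr rfl fun b _ => ?_
    rw [add_assoc, add_comm 1 k]
  induction k using Int.induction_on with
  | zero => simp
  | succ k ih => rw [key, ih]
  | pred k ih => rw [← ih, ← key]; simp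

/-- the full sum of weights. -/
def GF (N : ℕ) (τ S y : ℂ) : ℂ :=
  ∑ a ∈ Finset.range N, ∑ b ∈ Finset.range N, wF N τ a b S y

lemma GF_shift_one {N : ℕ} (hN : N ≠ 0) (τ S y : ℂ) : GF N τ S (y + 1 / N) = GF N τ S y := by
  unfold GF
  refine Finset.sum_congr rfl fun a _ => ?_
  simp only [wF_shift_one]
  exact sum_periodic_one N (fun b => wF N τ a b S y) fun b => wF_add_right hN τ a b S y

lemma GF_shift_tau {N : ℕ} (hN : N ≠ 0) (τ S y : ℂ) :
    GF N τ S (y + τ / N) = eπ (-2 * (S / N)) * GF N τ S y := by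
  unfold GF
  simp only [wF_shift_tau, ← Finset.mul_sum]
  congr 1
  exact sum_periodic_one N (fun a => ∑ b ∈ Finset.range N, wF N τ a b S y)
    fun a => Finset.sum_congr rfl fun b _ => wF_add_left hN τ a b S y

lemma omega_ne {N : ℕ} (hN : N ≠ 0) {τ : ℂ} (hτ : 0 < τ.im) (w : ℂ) (hw : tT τ w ≠ 0) (a b : ℤ)
    (h : tT τ ((a * τ + b) / N) = 0) : (N : ℤ) ∣ a ∧ (N : ℤ) ∣ b := by
  have hN' : (N : ℂ) ≠ 0 := by exact_mod_cast hN
  obtain ⟨n, m, e⟩ := (tT_eq_zero_iff hτ w hw _).1 h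
  have e' : (a : ℂ) * τ + b = (N * n : ℤ) + (N * m : ℤ) * τ := by
    field_simp at e
    push_cast
    linear_combination e
  have hi := congrArg Complex.im e'
  simp at hi
  have hi' : (a : ℝ) = N * m := by
    rcases hi with h | h
    · exact h
    · exact absurd h hτ.ne'
  have hi'' : a = N * m := by exact_mod_cast hi'
  have hr : b = N * n := by
    rw [hi''] at e'
    push_cast at e'
    have : (b : ℂ) = N * n := by linear_combination e'
    exact_mod_cast this
  exact ⟨⟨m, hi''⟩, ⟨n, hr⟩⟩

lemma tT_mul_ne {N : ℕ} (hN : N ≠ 0) {τ : ℂ} (hτ : 0 < τ.im) (u : ℂ) (hu : tT τ u ≠ 0)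
    (a b : ℤ) : tT τ (u / N + (a * τ + b) / N) ≠ 0 := by
  have hN' : (N : ℂ) ≠ 0 := by exact_mod_cast hN
  intro h
  obtain ⟨n, m, e⟩ := (tT_eq_zero_iff hτ u hu _).1 h
  apply hu
  rw [tT_eq_zero_iff hτ u hu]
  refine ⟨N * n - b, N * m - a, ?_⟩
  field_simp at e
  push_cast
  linear_combination e

lemma tT_analyticAt {τ : ℂ} (hτ : 0 < τ.im) (u : ℂ) : AnalyticAt ℂ (tT τ) u :=
  (tT_differentiable hτ).analyticAt u

lemma wF_analyticAt {N : ℕ} {τ : ℂ} (hτ : 0 < τ.im) (a b : ℤ) (S u : ℂ)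
    (h : tT τ (u / N + (a * τ + b) / N) ≠ 0) :
    AnalyticAt ℂ (fun v => wF N τ a b S (v / N)) u := by
  unfold wF
  have hd := tT_differentiable hτ
  refine analyticAt_const.mul (AnalyticAt.div ?_ ?_ h)
  · exact (show Differentiable ℂ fun v : ℂ => tT τ (S + (v / N + (a * τ + b) / N)) by
      fun_prop).analyticAt u
  · exact (show Differentiable ℂ fun v : ℂ => tT τ (v / N + (a * τ + b) / N) by
      fun_prop).analyticAt u

open Filter Topology in
/-- the sum of all the weights. -/
lemma GF_eq {N : ℕ} (hN : N ≠ 0) {τ : ℂ} (hτ : 0 < τ.im) (S u : ℂ) (hS : tT τ (S / N) ≠ 0)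
    (hu : tT τ u ≠ 0) :
    tT τ (S / N) * tT τ u * GF N τ S (u / N) = N * tT τ S * tT τ (S / N + u) := by
  have hN' : (N : ℂ) ≠ 0 := by exact_mod_cast hN
  have hd := tT_differentiable hτ
  set c : ℂ := N * tT τ S / tT τ (S / N) with hc
  set E : ℂ → ℂ := fun v => GF N τ S (v / N) - c * (tT τ (S / N + v) / tT τ v) with hE
  set μ := eπ (-2 * (S / N)) with hμ
  have hμ0 : μ ≠ 0 := eπ_ne _
  have E1 : ∀ v, E (v + 1) = E v := by
    intro v
    simp only [hE]
    rw [add_div, GF_shift_one hN, ← add_assoc, tT_add_one, tT_add_one, neg_div_neg_eq]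
  have E2 : ∀ v, E (v + τ) = μ * E v := by
    intro v
    simp only [hE]
    have r : tT τ (S / N + (v + τ)) / tT τ (v + τ) = μ * (tT τ (S / N + v) / tT τ v) := by
      rw [← add_assoc, tT_add_tau, tT_add_tau, neg_mul (eπ _), neg_mul (eπ _),
        neg_div_neg_eq, show -τ - 2 * (S / N + v) = (-τ - 2 * v) + (-2 * (S / N)) by ring, eπ_add,
        mul_assoc, mul_div_mul_left _ _ (eπ_ne _), mul_div_assoc]
    rw [add_div, GF_shift_tau hN, r]
    ring
  have Ean : ∀ u, tT τ u ≠ 0 → AnalyticAt ℂ E u := by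
    intro u hu
    refine AnalyticAt.sub ?_ (analyticAt_const.mul (AnalyticAt.div ?_ (hd.analyticAt u) hu))
    · unfold GF
      refine Finset.analyticAt_fun_sum _ fun a _ => Finset.analyticAt_fun_sum _ fun b _ => ?_
      exact wF_analyticAt hτ a b S u (tT_mul_ne hN hτ u hu a b)
    · exact (show Differentiable ℂ fun v : ℂ => tT τ (S / N + v) by fun_prop).analyticAt u
  have E0 : ∃ g : ℂ → ℂ, AnalyticAt ℂ g 0 ∧ E =ᶠ[𝓝[≠] 0] g := by
    set t := dslope (tT τ) 0 with ht
    have htan : AnalyticAt ℂ t 0 := analyticAt_dslope (hd.analyticAt 0)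
    have ht0 : t 0 ≠ 0 := by
      rw [ht, dslope_same]
      exact tT_deriv_ne hτ u hu
    have hTt : ∀ v, tT τ v = v * t v := eq_mul_dslope (tT_zero τ)
    set k : ℂ → ℂ := fun v => N * (tT τ (S + v / N) / t (v / N)) - c * (tT τ (S / N + v) / t v)
      with hk
    have hkan : AnalyticAt ℂ k 0 := by
      refine AnalyticAt.sub (analyticAt_const.mul (AnalyticAt.div ?_ ?_ ?_))
        (analyticAt_const.mul (AnalyticAt.div ?_ htan ht0))
      · exact (show Differentiable ℂ fun v : ℂ => tT τ (S + v / N) by fun_prop).analyticAt 0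
      · have h1 : AnalyticAt ℂ (fun v : ℂ => v / (N : ℂ)) 0 :=
          (show Differentiable ℂ fun v : ℂ => v / (N : ℂ) by fun_prop).analyticAt 0
        exact AnalyticAt.fun_comp (g := t) (f := fun v : ℂ => v / (N : ℂ)) (by simpa using htan) h1
      · simpa using ht0
      · exact (show Differentiable ℂ fun v : ℂ => tT τ (S / N + v) by fun_prop).analyticAt 0
    have hk0 : k 0 = 0 := by
      simp only [hk, zero_div, add_zero, hc]
      field_simp
      ring
    refine ⟨fun v => dslope k 0 v + ∑ p ∈ (Finset.range N ×ˢ Finset.range N).erase (0, 0),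
      wF N τ p.1 p.2 S (v / N), ?_, ?_⟩
    · refine (analyticAt_dslope hkan).add (Finset.analyticAt_fun_sum _ fun p hp => ?_)
      refine wF_analyticAt hτ _ _ S 0 ?_
      rw [zero_div, zero_add]
      intro h
      obtain ⟨h1, h2⟩ := omega_ne hN hτ u hu _ _ h
      simp only [Finset.mem_erase, Finset.mem_product, Finset.mem_range, ne_eq] at hp
      apply hp.1
      ext
      · exact Nat.eq_zero_of_dvd_of_lt (by exact_mod_cast h1) hp.2.1
      · exact Nat.eq_zero_of_dvd_of_lt (by exact_mod_cast h2) hp.2.2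
    · filter_upwards [self_mem_nhdsWithin] with v hv
      have hv0 : v ≠ 0 := hv
      have e1 : GF N τ S (v / N) = wF N τ 0 0 S (v / N) +
          ∑ p ∈ (Finset.range N ×ˢ Finset.range N).erase (0, 0),
            wF N τ p.1 p.2 S (v / N) := by
        unfold GF
        rw [← Finset.sum_product' (Finset.range N) (Finset.range N)
          (fun a b => wF N τ a b S (v / N)),
          ← Finset.add_sum_erase _ _ (show ((0 : ℕ), (0 : ℕ)) ∈ Finset.range N ×ˢ Finset.range N by
            simp [Nat.pos_of_ne_zero hN])]
        simp
      have e2 : dslope k 0 v = k v / v := by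
        rw [eq_mul_dslope hk0 v]
        field_simp
      have e3 : wF N τ 0 0 S (v / N) - c * (tT τ (S / N + v) / tT τ v) = k v / v := by
        simp only [hk, wF]
        rw [hTt v, hTt (v / N + _)]
        simp only [Int.cast_zero, zero_mul, zero_div, mul_zero, add_zero, eπ_zero]
        generalize t v = A
        generalize t (v / N) = B
        generalize tT τ (S / N + v) = A'
        generalize tT τ (S + v / N) = B'
        field_simp
      show GF N τ S (v / N) - c * (tT τ (S / N + v) / tT τ v) = dslope k 0 v + _
      rw [e2, e1]
      linear_combination e3
  obtain ⟨C, κ, hCE, hC⟩ := liouville_quasi τ hτ E μ hμ0 (by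
    intro v
    by_cases hv : tT τ v = 0
    · obtain ⟨n, m, rfl⟩ := (tT_eq_zero_iff hτ u hu v).1 hv
      exact transport_ext E τ μ hμ0 E1 E2 E0 n m
    · exact ⟨E, Ean v hv, EventuallyEq.rfl⟩) E1 E2
  have hC0 : C = 0 := by
    rcases hC with h | ⟨h1, h2⟩
    · exact h
    · exfalso
      obtain ⟨n, hn⟩ := Complex.exp_eq_one_iff.1 h1
      rw [hn, hμ, eπ] at h2
      obtain ⟨m, hm⟩ := Complex.exp_eq_exp_iff_exists_int.1 h2
      apply hS
      rw [tT_eq_zero_iff hτ u hu]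
      refine ⟨m, -n, ?_⟩
      have hp : (2 * Real.pi * Complex.I : ℂ) ≠ 0 := Complex.two_pi_I_ne_zero
      have : (2 * Real.pi * Complex.I : ℂ) * (S / N) = (2 * Real.pi * Complex.I : ℂ) *
        ((m : ℤ) + (-n : ℤ) * τ) := by
        push_cast
        linear_combination hm
      exact mul_left_cancel₀ hp this
  have hEu : E u = 0 := by
    refine tendsto_nhds_unique (((Ean u hu).continuousAt.tendsto).mono_left
      (nhdsWithin_le_nhds (s := {u}ᶜ))) ?_
    refine Tendsto.congr' (hCE u).symm ?_
    simp [hC0]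
  have := sub_eq_zero.1 hEu
  rw [this, hc]
  field_simp

/-- the convolution sum of weights. -/
def conv (N : ℕ) (τ : ℂ) (c d : ℤ) (x y x' y' : ℂ) : ℂ :=
  ∑ a ∈ Finset.range N, ∑ b ∈ Finset.range N, wF N τ (a + c) (b + d) x y * wF N τ a b x' y'

lemma wF_fay {N : ℕ} {τ : ℂ} (hτ : 0 < τ.im) (a b c d : ℤ) (x y x' y' : ℂ)
    (hy : tT τ (y + ((a + c : ℤ) * τ + (b + d : ℤ)) / N) ≠ 0)
    (hy' : tT τ (y' + (a * τ + b) / N) ≠ 0) :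
    tT τ (y - y' + (c * τ + d) / N) * tT τ (x + x') *
      (wF N τ (a + c) (b + d) x y * wF N τ a b x' y') =
    eπ (2 * (c / N) * x) * tT τ (x + (y - y' + (c * τ + d) / N)) * tT τ x' *
        wF N τ a b (x + x') y' -
      eπ (-(2 * (c / N) * x')) * tT τ (x' - (y - y' + (c * τ + d) / N)) * tT τ x *
        wF N τ (a + c) (b + d) (x + x') y := by
  have h := tT_fay hτ x (y + ((a + c : ℤ) * τ + (b + d : ℤ)) / N) x' (y' + (a * τ + b) / N)
  rw [show y + ((a + c : ℤ) * τ + (b + d : ℤ)) / N - (y' + (a * τ + b) / N) =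
    y - y' + (c * τ + d) / N by push_cast; ring] at h
  unfold wF
  generalize tT τ (y - y' + (c * τ + d) / N) = TD at h ⊢
  generalize tT τ (x + (y - y' + (c * τ + d) / N)) = TxD at h ⊢
  generalize tT τ (x' - (y - y' + (c * τ + d) / N)) = TxD' at h ⊢
  generalize y + ((a + c : ℤ) * τ + (b + d : ℤ)) / N = Y at h hy ⊢
  generalize y' + (a * τ + b) / N = Y' at h hy' ⊢
  have e1 : eπ (2 * (((a + c : ℤ) : ℂ) / N) * x) = eπ (2 * (a / N) * x) * eπ (2 * (c / N) * x) := by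
    rw [← eπ_add]; congr 1; push_cast; ring
  have e2 : eπ (2 * ((a : ℂ) / N) * (x + x')) = eπ (2 * (a / N) * x) * eπ (2 * (a / N) * x') := by
    rw [← eπ_add]; congr 1; ring
  have e3 : eπ (2 * (((a + c : ℤ) : ℂ) / N) * (x + x')) = eπ (2 * (a / N) * x) *
      eπ (2 * (c / N) * x) * eπ (2 * (a / N) * x') * eπ (2 * (c / N) * x') := by
    rw [← eπ_add, ← eπ_add, ← eπ_add]; congr 1; push_cast; ring
  rw [e1, e2, e3, eπ_neg]
  have h1 := eπ_ne (2 * (c / N) * x')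
  generalize eπ (2 * (c / N) * x') = E1 at h1 ⊢
  generalize eπ (2 * (c / N) * x) = E2
  generalize eπ (2 * (a / N) * x') = E3
  generalize eπ (2 * (a / N) * x) = E4
  field_simp
  linear_combination E4 * E2 * E3 * h

lemma GF_shift {N : ℕ} (hN : N ≠ 0) (τ : ℂ) (c d : ℤ) (S y : ℂ) :
    ∑ a ∈ Finset.range N, ∑ b ∈ Finset.range N, wF N τ (a + c) (b + d) S y = GF N τ S y := by
  unfold GF
  rw [← sum_periodic N (fun a => ∑ b ∈ Finset.range N, wF N τ a b S y)
    (fun a => Finset.sum_congr rfl fun b _ => wF_add_left hN τ a b S y) c]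
  refine Finset.sum_congr rfl fun a _ => ?_
  exact sum_periodic N (fun b => wF N τ (a + c) b S y)
    (fun b => wF_add_right hN τ _ b S y) d

lemma conv_fay {N : ℕ} (hN : N ≠ 0) {τ : ℂ} (hτ : 0 < τ.im) (c d : ℤ) (x x' u u' : ℂ)
    (hu : tT τ u ≠ 0) (hu' : tT τ u' ≠ 0) :
    tT τ (u / N - u' / N + (c * τ + d) / N) * tT τ (x + x') * conv N τ c d x (u / N) x' (u' / N) =
    eπ (2 * (c / N) * x) * tT τ (x + (u / N - u' / N + (c * τ + d) / N)) * tT τ x' *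
        GF N τ (x + x') (u' / N) -
      eπ (-(2 * (c / N) * x')) * tT τ (x' - (u / N - u' / N + (c * τ + d) / N)) * tT τ x *
        GF N τ (x + x') (u / N) := by
  rw [← GF_shift hN τ c d (x + x') (u / N)]
  unfold conv GF
  simp only [Finset.mul_sum]
  rw [← Finset.sum_sub_distrib]
  refine Finset.sum_congr rfl fun a _ => ?_
  rw [← Finset.sum_sub_distrib]
  refine Finset.sum_congr rfl fun b _ => ?_
  exact wF_fay hτ a b c d x _ x' _ (tT_mul_ne hN hτ u hu _ _) (tT_mul_ne hN hτ u' hu' _ _)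

open Filter Topology in
lemma conv_eq {N : ℕ} (hN : N ≠ 0) {τ : ℂ} (hτ : 0 < τ.im) (c d : ℤ) (x x' u u' : ℂ)
    (hu : tT τ u ≠ 0) (hu' : tT τ u' ≠ 0) :
    tT τ (u / N - u' / N + (c * τ + d) / N) * tT τ ((x + x') / N) * tT τ u * tT τ u' *
      conv N τ c d x (u / N) x' (u' / N) =
    N * (eπ (2 * (c / N) * x) * tT τ (x + (u / N - u' / N + (c * τ + d) / N)) * tT τ x' *
        tT τ ((x + x') / N + u') * tT τ u -
      eπ (-(2 * (c / N) * x')) * tT τ (x' - (u / N - u' / N + (c * τ + d) / N)) * tT τ x *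
        tT τ ((x + x') / N + u) * tT τ u') := by
  have hd := (tT_differentiable hτ).continuous
  have he : Continuous eπ := eπ_differentiable.continuous
  refine punct_unique (f := fun x' => tT τ (u / N - u' / N + (c * τ + d) / N) *
      tT τ ((x + x') / N) * tT τ u * tT τ u' * conv N τ c d x (u / N) x' (u' / N))
    (g := fun x' => N * (eπ (2 * (c / N) * x) *
        tT τ (x + (u / N - u' / N + (c * τ + d) / N)) * tT τ x' *
        tT τ ((x + x') / N + u') * tT τ u -
      eπ (-(2 * (c / N) * x')) * tT τ (x' - (u / N - u' / N + (c * τ + d) / N)) * tT τ x *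
        tT τ ((x + x') / N + u) * tT τ u')) ?_ ?_ x' ?_
  · unfold conv wF
    fun_prop
  · fun_prop
  · have h := (tendsto_punct_add x' x).eventually (tT_eventually_ne hτ u hu (x' + x))
    filter_upwards [h] with v hv
    rw [add_comm] at hv
    have hvN : tT τ ((x + v) / N) ≠ 0 := by
      have := tT_mul_ne hN hτ (x + v) hv 0 0
      simpa using this
    have h1 := conv_fay hN hτ c d x v u u' hu hu'
    have g1 := GF_eq hN hτ (x + v) u hvN hu
    have g2 := GF_eq hN hτ (x + v) u' hvN hu'
    apply mul_left_cancel₀ hv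
    generalize tT τ (u / N - u' / N + (c * τ + d) / N) = A1 at *
    generalize eπ (2 * (c / N) * x) * tT τ (x + (u / N - u' / N + (c * τ + d) / N)) * tT τ v = A2
      at *
    generalize eπ (-(2 * (c / N) * v)) * tT τ (v - (u / N - u' / N + (c * τ + d) / N)) * tT τ x = A3
      at *
    linear_combination tT τ ((x + v) / N) * tT τ u * tT τ u' * h1 + A2 * tT τ u * g2 -
      A3 * tT τ u' * g1

lemma conv_zero {N : ℕ} (hN : N ≠ 0) {τ : ℂ} (hτ : 0 < τ.im) (c d : ℤ) (x x' ζ : ℂ)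
    (hζ : tT τ ζ ≠ 0) (hx : x + x' = -(N * ζ)) (hcd : ¬ ((N : ℤ) ∣ c ∧ (N : ℤ) ∣ d)) :
    conv N τ c d x (ζ / N) x' (ζ / N) = 0 := by
  have hN' : (N : ℂ) ≠ 0 := by exact_mod_cast hN
  have h := conv_eq hN hτ c d x x' ζ ζ hζ hζ
  have h1 : (x + x') / N = -ζ := by rw [hx]; field_simp
  rw [h1, neg_add_cancel, tT_zero, tT_neg, sub_self, zero_add] at h
  simp only [mul_zero, zero_mul, sub_self] at h
  have h2 : tT τ ((c * τ + d) / N) ≠ 0 := fun e => hcd (omega_ne hN hτ ζ hζ c d e)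
  have h3 : tT τ ((c * τ + d) / N) * -tT τ ζ * tT τ ζ * tT τ ζ ≠ 0 := by
    simp [h2, hζ]
  exact (mul_eq_zero.1 h).resolve_left h3

open Filter Topology in
lemma conv_one {N : ℕ} (hN : N ≠ 0) {τ : ℂ} (hτ : 0 < τ.im) (x x' ζ : ℂ)
    (hζ : tT τ ζ ≠ 0) (hx : x + x' = -(N * ζ)) :
    tT τ ζ ^ 2 * conv N τ 0 0 x (ζ / N) x' (ζ / N) = N ^ 2 * tT τ x * tT τ x' := by
  have hN' : (N : ℂ) ≠ 0 := by exact_mod_cast hN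
  have h1 : (x + x') / N = -ζ := by rw [hx]; field_simp
  have hd := (tT_differentiable hτ)
  have hc := hd.continuous
  set t := dslope (tT τ) 0 with ht
  have htan : ContinuousAt t 0 := (analyticAt_dslope (hd.analyticAt 0)).continuousAt
  have ht0 : t 0 ≠ 0 := by
    rw [ht, dslope_same]
    exact tT_deriv_ne hτ ζ hζ
  have hTt : ∀ v, tT τ v = v * t v := eq_mul_dslope (tT_zero τ)
  have hev : ∀ᶠ e in 𝓝 (0 : ℂ), tT τ (ζ - N * e) ≠ 0 := by
    have : ContinuousAt (fun e : ℂ => tT τ (ζ - N * e)) 0 := by fun_prop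
    exact this.eventually_ne (by simpa using hζ)
  have hconv : ContinuousAt (fun e : ℂ => conv N τ 0 0 x (ζ / N) x' ((ζ - N * e) / N)) 0 := by
    unfold conv wF
    refine tendsto_finsetSum _ fun a _ => tendsto_finsetSum _ fun b _ => ?_
    refine ContinuousAt.mul continuousAt_const (ContinuousAt.mul continuousAt_const
      (ContinuousAt.div ?_ ?_ ?_))
    · fun_prop
    · fun_prop
    · have := tT_mul_ne hN hτ ζ hζ a b
      simpa using this
  have L1 : Tendsto (fun e : ℂ => t e * tT τ (-ζ) * tT τ ζ * tT τ (ζ - N * e) *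
      conv N τ 0 0 x (ζ / N) x' ((ζ - N * e) / N)) (𝓝[≠] 0)
      (𝓝 (t 0 * tT τ (-ζ) * tT τ ζ * tT τ (ζ - N * 0) *
        conv N τ 0 0 x (ζ / N) x' ((ζ - N * 0) / N))) := by
    refine Tendsto.mono_left ?_ nhdsWithin_le_nhds
    refine ContinuousAt.tendsto (f := fun e : ℂ => t e * tT τ (-ζ) * tT τ ζ * tT τ (ζ - N * e) *
      conv N τ 0 0 x (ζ / N) x' ((ζ - N * e) / N)) ?_
    refine ContinuousAt.mul (ContinuousAt.mul ((htan.mul continuousAt_const).mul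
      continuousAt_const) ?_) hconv
    fun_prop
  have L2 : Tendsto (fun e : ℂ => -(N : ℂ) ^ 2 * tT τ (x + e) * tT τ x' * t (-(N * e)) * tT τ ζ)
      (𝓝[≠] 0) (𝓝 (-(N : ℂ) ^ 2 * tT τ (x + 0) * tT τ x' * t (-(N * 0)) * tT τ ζ)) := by
    refine Tendsto.mono_left ?_ nhdsWithin_le_nhds
    refine ContinuousAt.tendsto (f := fun e : ℂ => -(N : ℂ) ^ 2 * tT τ (x + e) * tT τ x' *
      t (-(N * e)) * tT τ ζ) ?_
    have ht2 : ContinuousAt (fun e : ℂ => t (-(N * e))) 0 :=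
      ContinuousAt.comp (g := t) (f := fun e : ℂ => -(N * e)) (by simpa using htan) (by fun_prop)
    refine ContinuousAt.mul (ContinuousAt.mul ?_ ht2) continuousAt_const
    fun_prop
  have key := tendsto_nhds_unique L1 (L2.congr' ?_)
  · simp only [mul_zero, sub_zero, add_zero, neg_zero, tT_neg] at key
    have : (t 0 * tT τ ζ) * (tT τ ζ ^ 2 * conv N τ 0 0 x (ζ / N) x' (ζ / N)) =
      (t 0 * tT τ ζ) * (N ^ 2 * tT τ x * tT τ x') := by linear_combination -key
    exact mul_left_cancel₀ (mul_ne_zero ht0 hζ) this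
  · filter_upwards [self_mem_nhdsWithin, nhdsWithin_le_nhds hev] with e he0 he
    have he0' : e ≠ 0 := he0
    have h := conv_eq hN hτ 0 0 x x' ζ (ζ - N * e) hζ he
    rw [h1, neg_add_cancel, tT_zero, show -ζ + (ζ - N * e) = -(N * e) by ring,
      show ζ / N - (ζ - N * e) / N + (((0 : ℤ) : ℂ) * τ + ((0 : ℤ) : ℂ)) / N = e by
        push_cast; field_simp; ring, hTt e, hTt (-(N * e))] at h
    simp only [Int.cast_zero, zero_div, mul_zero, zero_mul, eπ_zero, one_mul, sub_zero] at h
    apply mul_left_cancel₀ he0'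
    linear_combination -h

lemma pp_step {N : ℕ} (hN : N ≠ 0) {ζ τ : ℂ} (hτ : 0 < τ.im) (hζ : 0 < ζ.im) (v w : ℂ)
    (h : w = v + 2 * N * ζ) :
    poch2 (eπ v) (eπ (2 * τ)) (eπ (2 * N * ζ)) =
      poch1 (eπ v) (eπ (2 * τ)) * poch2 (eπ w) (eπ (2 * τ)) (eπ (2 * N * ζ)) := by
  have hs : ‖eπ (2 * N * ζ)‖ < 1 := by
    refine norm_eπ_lt ?_
    have : (2 * N * ζ : ℂ) = ((2 * N : ℝ) : ℂ) * ζ := by push_cast; ring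
    rw [this, Complex.im_ofReal_mul]
    have : (0 : ℝ) < N := by exact_mod_cast Nat.pos_of_ne_zero hN
    positivity
  rw [poch2_step (norm_p hτ) hs, h, eπ_add]

lemma kappa_cross {N : ℕ} (hN : N ≠ 0) {ξ ζ τ : ℂ} (hτ : 0 < τ.im) (hζ : 0 < ζ.im)
    (h1 : kappaDen N ξ ζ τ ≠ 0) (h2 : kappaDen N (-ξ - N * ζ) ζ τ ≠ 0) :
    (kappaNum N ξ ζ τ / kappaDen N ξ ζ τ) *
      (kappaNum N (-ξ - N * ζ) ζ τ / kappaDen N (-ξ - N * ζ) ζ τ) *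
      (tT τ ξ * tT τ (-ξ - N * ζ)) =
    eπ (2 * ζ - 2 * N * ζ) * (tT τ (ξ + ζ) * tT τ (-ξ - N * ζ + ζ)) := by
  obtain ⟨C, hC⟩ := tT_eq_tB hτ
  have s1 := pp_step hN hτ hζ (-2 * ξ) (2 * N * ζ - 2 * ξ) (by ring)
  have s2 := pp_step hN hτ hζ (2 * ξ + 2 * N * ζ) (2 * ξ + 4 * N * ζ) (by ring)
  have s3 := pp_step hN hτ hζ (2 * ζ + 2 * ξ) (2 * ζ + 2 * ξ + 2 * N * ζ) (by ring)
  have s4 := pp_step hN hτ hζ (2 * ζ - 2 * ξ - 2 * N * ζ) (2 * ζ - 2 * ξ) (by ring)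
  have s5 := pp_step hN hτ hζ (2 * τ - 2 * ξ - 2 * N * ζ) (2 * τ - 2 * ξ) (by ring)
  have s6 := pp_step hN hτ hζ (2 * τ + 2 * ξ) (2 * τ + 2 * ξ + 2 * N * ζ) (by ring)
  have s7 := pp_step hN hτ hζ (2 * τ + (2 * N - 2) * ζ + 2 * ξ)
    (2 * τ + (4 * N - 2) * ζ + 2 * ξ) (by ring)
  have s8 := pp_step hN hτ hζ (2 * τ - 2 * ζ - 2 * ξ) (2 * τ + (2 * N - 2) * ζ - 2 * ξ) (by ring)
  have t0 : tT τ ξ * tT τ (-ξ - N * ζ) = tT τ (-ξ) * tT τ (-(-ξ - N * ζ)) := by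
    rw [tT_neg, tT_neg]; ring
  have b1 : tT τ (ξ + ζ) = C * (eπ (-(ξ + ζ)) * poch1 (eπ (2 * ζ + 2 * ξ)) (eπ (2 * τ)) *
      poch1 (eπ (2 * τ - 2 * ζ - 2 * ξ)) (eπ (2 * τ))) := by
    rw [hC, tB, ← eπ_add]
    ring_nf
  have b2 : tT τ (-ξ - N * ζ + ζ) = C * (eπ (ξ + N * ζ - ζ) *
      poch1 (eπ (2 * ζ - 2 * ξ - 2 * N * ζ)) (eπ (2 * τ)) *
      poch1 (eπ (2 * τ + (2 * N - 2) * ζ + 2 * ξ)) (eπ (2 * τ))) := by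
    rw [hC, tB, ← eπ_add]
    ring_nf
  have b3 : tT τ (-ξ) = C * (eπ ξ * poch1 (eπ (-2 * ξ)) (eπ (2 * τ)) *
      poch1 (eπ (2 * τ + 2 * ξ)) (eπ (2 * τ))) := by
    rw [hC, tB, ← eπ_add]
    ring_nf
  have b4 : tT τ (-(-ξ - N * ζ)) = C * (eπ (-ξ - N * ζ) *
      poch1 (eπ (2 * ξ + 2 * N * ζ)) (eπ (2 * τ)) *
      poch1 (eπ (2 * τ - 2 * ξ - 2 * N * ζ)) (eπ (2 * τ))) := by
    rw [hC, tB, ← eπ_add]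
    ring_nf
  have ee : eπ ξ * eπ (-ξ - N * ζ) =
      eπ (2 * ζ - 2 * N * ζ) * (eπ (-(ξ + ζ)) * eπ (ξ + N * ζ - ζ)) := by
    rw [← eπ_add, ← eπ_add, ← eπ_add]; congr 1; ring
  rw [t0, b1, b2, b3, b4]
  have k1 : kappaDen N ξ ζ τ = poch2 (eπ (2 * ξ + 2 * N * ζ)) (eπ (2 * τ)) (eπ (2 * N * ζ)) *
      poch2 (eπ (2 * ζ - 2 * ξ)) (eπ (2 * τ)) (eπ (2 * N * ζ)) *
      poch2 (eπ (2 * τ + 2 * ξ)) (eπ (2 * τ)) (eπ (2 * N * ζ)) *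
      poch2 (eπ (2 * τ + (2 * N - 2) * ζ - 2 * ξ)) (eπ (2 * τ)) (eπ (2 * N * ζ)) := by
    unfold kappaDen kappaNum
    ring_nf
  have k2 : kappaDen N (-ξ - N * ζ) ζ τ = poch2 (eπ (-2 * ξ)) (eπ (2 * τ)) (eπ (2 * N * ζ)) *
      poch2 (eπ (2 * ζ + 2 * ξ + 2 * N * ζ)) (eπ (2 * τ)) (eπ (2 * N * ζ)) *
      poch2 (eπ (2 * τ - 2 * ξ - 2 * N * ζ)) (eπ (2 * τ)) (eπ (2 * N * ζ)) *
      poch2 (eπ (2 * τ + (4 * N - 2) * ζ + 2 * ξ)) (eπ (2 * τ)) (eπ (2 * N * ζ)) := by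
    unfold kappaDen kappaNum
    ring_nf
  have k3 : kappaNum N (-ξ - N * ζ) ζ τ =
      poch2 (eπ (2 * ξ + 4 * N * ζ)) (eπ (2 * τ)) (eπ (2 * N * ζ)) *
      poch2 (eπ (2 * ζ - 2 * ξ - 2 * N * ζ)) (eπ (2 * τ)) (eπ (2 * N * ζ)) *
      poch2 (eπ (2 * τ + 2 * ξ + 2 * N * ζ)) (eπ (2 * τ)) (eπ (2 * N * ζ)) *
      poch2 (eπ (2 * τ - 2 * ζ - 2 * ξ)) (eπ (2 * τ)) (eπ (2 * N * ζ)) := by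
    unfold kappaNum
    ring_nf
  rw [div_mul_div_comm, div_mul_eq_mul_div, div_eq_iff (mul_ne_zero h1 h2), k1, k2, k3, kappaNum,
    s1, s2, s3, s4, s5, s6, s7, s8]
  generalize eπ ξ = Z1 at *
  generalize eπ (-ξ - N * ζ) = Z2 at *
  generalize eπ (-(ξ + ζ)) = Z3 at *
  generalize eπ (ξ + N * ζ - ζ) = Z4 at *
  generalize eπ (2 * ζ - 2 * N * ζ) = Z5 at *
  clear s1 s2 s3 s4 s5 s6 s7 s8 b1 b2 b3 b4 k1 k2 k3 h1 h2
  generalize poch1 (eπ (2 * ζ + 2 * ξ)) (eπ (2 * τ)) = p1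
  generalize poch1 (eπ (2 * τ - 2 * ζ - 2 * ξ)) (eπ (2 * τ)) = p2
  generalize poch1 (eπ (2 * ζ - 2 * ξ - 2 * N * ζ)) (eπ (2 * τ)) = p3
  generalize poch1 (eπ (2 * τ + (2 * N - 2) * ζ + 2 * ξ)) (eπ (2 * τ)) = p4
  generalize poch1 (eπ (-2 * ξ)) (eπ (2 * τ)) = p5
  generalize poch1 (eπ (2 * τ + 2 * ξ)) (eπ (2 * τ)) = p6
  generalize poch1 (eπ (2 * ξ + 2 * N * ζ)) (eπ (2 * τ)) = p7
  generalize poch1 (eπ (2 * τ - 2 * ξ - 2 * N * ζ)) (eπ (2 * τ)) = p8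
  generalize poch2 (eπ (2 * N * ζ - 2 * ξ)) (eπ (2 * τ)) (eπ (2 * N * ζ)) = r1
  generalize poch2 (eπ (2 * ξ + 4 * N * ζ)) (eπ (2 * τ)) (eπ (2 * N * ζ)) = r2
  generalize poch2 (eπ (2 * ζ + 2 * ξ + 2 * N * ζ)) (eπ (2 * τ)) (eπ (2 * N * ζ)) = r3
  generalize poch2 (eπ (2 * ζ - 2 * ξ)) (eπ (2 * τ)) (eπ (2 * N * ζ)) = r4
  generalize poch2 (eπ (2 * τ - 2 * ξ)) (eπ (2 * τ)) (eπ (2 * N * ζ)) = r5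
  generalize poch2 (eπ (2 * τ + 2 * ξ + 2 * N * ζ)) (eπ (2 * τ)) (eπ (2 * N * ζ)) = r6
  generalize poch2 (eπ (2 * τ + (4 * N - 2) * ζ + 2 * ξ)) (eπ (2 * τ)) (eπ (2 * N * ζ)) = r7
  generalize poch2 (eπ (2 * τ + (2 * N - 2) * ζ - 2 * ξ)) (eπ (2 * τ)) (eπ (2 * N * ζ)) = r8
  linear_combination C ^ 2 * p1 * p2 * p3 * p4 * p5 * p6 * p7 * p8 *
    r1 * r2 * r3 * r4 * r5 * r6 * r7 * r8 * ee

/-- conjugation homomorphism. -/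
def Kf (N : ℕ) : Matrix (Fin N) (Fin N) ℂ →* Matrix (Fin N × Fin N) (Fin N × Fin N) ℂ where
  toFun A := A ⊗ₖ (A⁻¹)ᵀ
  map_one' := by simp
  map_mul' A B := by
    rw [Matrix.mul_inv_rev, Matrix.transpose_mul, Matrix.mul_kronecker_mul]

lemma Kf_apply (N : ℕ) (A : Matrix (Fin N) (Fin N) ℂ) : Kf N A = A ⊗ₖ (A⁻¹)ᵀ := rfl

lemma gMat_pow {N : ℕ} (hN : N ≠ 0) : gMat N ^ N = 1 := by
  have hN' : (N : ℂ) ≠ 0 := by exact_mod_cast hN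
  rw [gMat, Matrix.diagonal_pow, ← Matrix.diagonal_one]
  congr 1
  ext j
  rw [Pi.pow_apply, eπ_pow]
  have := eπ_two_int ((j : ℕ) + 1 : ℤ)
  rw [show (N : ℂ) * (2 * (((j : ℕ) : ℂ) + 1) / N) = 2 * ((((j : ℕ) + 1 : ℤ)) : ℂ) by
    push_cast; field_simp]
  exact this

lemma hMat_pow_apply {N : ℕ} (k : ℕ) (j l : Fin N) :
    (hMat N ^ k) j l = if (l : ℕ) = ((j : ℕ) + k) % N then 1 else 0 := by
  have hpos : 0 < N := j.pos
  induction k generalizing l with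
  | zero =>
    rw [pow_zero, Matrix.one_apply, add_zero, Nat.mod_eq_of_lt j.2]
    simp only [Fin.ext_iff]
    by_cases h : (j : ℕ) = l
    · rw [if_pos h, if_pos h.symm]
    · rw [if_neg h, if_neg (Ne.symm h)]
  | succ k ih =>
    rw [pow_succ, Matrix.mul_apply]
    rw [Finset.sum_eq_single (⟨((j : ℕ) + k) % N, Nat.mod_lt _ hpos⟩ : Fin N)]
    · rw [ih, if_pos rfl, one_mul, hMat, Matrix.of_apply]
      simp only [Nat.mod_add_mod, add_assoc]
    · intro m _ hm
      rw [ih, if_neg, zero_mul]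
      intro h
      exact hm (Fin.ext h)
    · intro h
      exact absurd (Finset.mem_univ _) h

lemma hMat_pow {N : ℕ} : hMat N ^ N = 1 := by
  ext j l
  rw [hMat_pow_apply, Nat.add_mod_right, Nat.mod_eq_of_lt j.2, Matrix.one_apply]
  by_cases h : j = l
  · rw [if_pos (by rw [h]), if_pos h]
  · rw [if_neg h, if_neg]
    intro h'
    exact h (Fin.ext h'.symm)

lemma hg_comm {N : ℕ} : hMat N * gMat N = eπ (2 / N) • (gMat N * hMat N) := by
  ext j l
  rw [gMat, Matrix.mul_diagonal, Matrix.smul_apply, Matrix.diagonal_mul, hMat, Matrix.of_apply,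
    smul_eq_mul]
  by_cases h : (l : ℕ) = ((j : ℕ) + 1) % N
  · rw [if_pos h, one_mul, mul_one, ← eπ_add]
    have hN' : (N : ℂ) ≠ 0 := by exact_mod_cast j.pos.ne'
    have hd := Nat.mod_add_div ((j : ℕ) + 1) N
    rw [← h] at hd
    obtain ⟨k, hk⟩ : ∃ k : ℕ, (l : ℕ) + N * k = (j : ℕ) + 1 := ⟨_, hd⟩
    have hd' : ((l : ℕ) : ℂ) + N * (k : ℂ) = (j : ℕ) + 1 := by exact_mod_cast hk
    refine eπ_congr_int (-(k : ℤ)) ?_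
    push_cast
    field_simp
    linear_combination hd'
  · rw [if_neg h]; simp

lemma Kf_smul {N : ℕ} (c : ℂ) (hc : c ≠ 0) (A : Matrix (Fin N) (Fin N) ℂ) (hA : IsUnit A.det) :
    Kf N (c • A) = Kf N A := by
  let _ := invertibleOfNonzero hc
  rw [Kf_apply, Kf_apply, Matrix.inv_smul A c hA, Matrix.transpose_smul, Matrix.smul_kronecker,
    Matrix.kronecker_smul, smul_smul, mul_invOf_self, one_smul]

lemma isUnit_det_of_pow {N : ℕ} (hN : N ≠ 0) {A : Matrix (Fin N) (Fin N) ℂ} (h : A ^ N = 1) :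
    IsUnit A.det :=
  (Matrix.isUnit_iff_isUnit_det A).1 (IsUnit.of_pow_eq_one h hN)

lemma K_comm {N : ℕ} (hN : N ≠ 0) : Commute (Kf N (gMat N)) (Kf N (hMat N)) := by
  unfold Commute SemiconjBy
  rw [← map_mul, ← map_mul, hg_comm, Kf_smul _ (eπ_ne _)]
  rw [Matrix.det_mul]
  exact (isUnit_det_of_pow hN (gMat_pow hN)).mul (isUnit_det_of_pow hN hMat_pow)

lemma Imat_unit {N : ℕ} (hN : N ≠ 0) (α : Fin N × Fin N) : IsUnit (Imat N α).det := by
  rw [Imat, Matrix.det_mul, Matrix.det_pow, Matrix.det_pow]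
  exact ((isUnit_det_of_pow hN (gMat_pow hN)).pow _).mul ((isUnit_det_of_pow hN hMat_pow).pow _)

/-- the doubled clock unit. -/
def gU {N : ℕ} (hN : N ≠ 0) : (Matrix (Fin N × Fin N) (Fin N × Fin N) ℂ)ˣ :=
  Units.ofPowEqOne (Kf N (gMat N)) N (by rw [← map_pow, gMat_pow hN, map_one]) hN
/-- the doubled shift unit. -/
def hU {N : ℕ} (hN : N ≠ 0) : (Matrix (Fin N × Fin N) (Fin N × Fin N) ℂ)ˣ :=
  Units.ofPowEqOne (Kf N (hMat N)) N (by rw [← map_pow, hMat_pow, map_one]) hN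

lemma ghU_comm {N : ℕ} (hN : N ≠ 0) : Commute (gU hN) (hU hN) := by
  rw [← Commute.units_val_iff]
  exact K_comm hN

lemma gU_pow {N : ℕ} (hN : N ≠ 0) : gU hN ^ (N : ℤ) = 1 := by
  rw [zpow_natCast]; exact Units.pow_ofPowEqOne _ hN
lemma hU_pow {N : ℕ} (hN : N ≠ 0) : hU hN ^ (N : ℤ) = 1 := by
  rw [zpow_natCast]; exact Units.pow_ofPowEqOne _ hN

/-- integer-indexed family of commuting matrices. -/
def UU {N : ℕ} (hN : N ≠ 0) (c d : ℤ) : Matrix (Fin N × Fin N) (Fin N × Fin N) ℂ :=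
  ((gU hN ^ d * hU hN ^ c : (Matrix (Fin N × Fin N) (Fin N × Fin N) ℂ)ˣ) :
    Matrix (Fin N × Fin N) (Fin N × Fin N) ℂ)

lemma UU_left {N : ℕ} (hN : N ≠ 0) (c d : ℤ) : UU hN (c + N) d = UU hN c d := by
  rw [UU, _root_.zpow_add, hU_pow, mul_one, UU]
lemma UU_right {N : ℕ} (hN : N ≠ 0) (c d : ℤ) : UU hN c (d + N) = UU hN c d := by
  rw [UU, _root_.zpow_add, gU_pow, mul_one, UU]
lemma UU_zero {N : ℕ} (hN : N ≠ 0) : UU hN 0 0 = 1 := by simp [UU]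

lemma K_Imat {N : ℕ} (hN : N ≠ 0) (α : Fin N × Fin N) :
    Imat N α ⊗ₖ ((Imat N α)⁻¹)ᵀ = UU hN (α.1 : ℕ) (α.2 : ℕ) := by
  rw [← Kf_apply, Imat, map_mul, map_pow, map_pow, UU, zpow_natCast, zpow_natCast]
  rfl

lemma UU_mul {N : ℕ} (hN : N ≠ 0) (a b c d : ℤ) : UU hN a b * UU hN c d = UU hN (a + c) (b + d) := by
  unfold UU
  rw [← Units.val_mul]
  congr 1
  rw [_root_.zpow_add, _root_.zpow_add, mul_assoc, mul_assoc, ← mul_assoc (hU hN ^ a),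
    ← mul_assoc (gU hN ^ d) (hU hN ^ a), ((ghU_comm hN).zpow_zpow d a).eq]

lemma K_Imat' {N : ℕ} (hN : N ≠ 0) (α : Fin N × Fin N) :
    (Imat N α)⁻¹ ⊗ₖ (Imat N α)ᵀ = UU hN (-(α.1 : ℕ)) (-(α.2 : ℕ)) := by
  have h1 : UU hN (-(α.1 : ℕ)) (-(α.2 : ℕ)) * UU hN (α.1 : ℕ) (α.2 : ℕ) = 1 := by
    rw [UU_mul, neg_add_cancel, neg_add_cancel, UU_zero]
  have h2 : UU hN (α.1 : ℕ) (α.2 : ℕ) * ((Imat N α)⁻¹ ⊗ₖ (Imat N α)ᵀ) = 1 := by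
    rw [← K_Imat, ← Matrix.mul_kronecker_mul, Matrix.mul_nonsing_inv _ (Imat_unit hN α),
      ← Matrix.transpose_mul, Matrix.mul_nonsing_inv _ (Imat_unit hN α)]
    simp
  exact (left_inv_eq_right_inv h1 h2).symm

lemma conv_sum {N : ℕ} (hN : N ≠ 0) (τ x y x' y' : ℂ)
    (h0 : ∀ c d : ℤ, ¬ ((N : ℤ) ∣ c ∧ (N : ℤ) ∣ d) → conv N τ c d x y x' y' = 0) :
    ∑ c ∈ Finset.range N, ∑ d ∈ Finset.range N, ∑ a ∈ Finset.range N, ∑ b ∈ Finset.range N,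
      (wF N τ a b x y * wF N τ c d x' y') • UU hN ((a : ℤ) - c) ((b : ℤ) - d) =
    conv N τ 0 0 x y x' y' • 1 := by
  have e1 : ∀ c d : ℤ, ∑ a ∈ Finset.range N, ∑ b ∈ Finset.range N,
      (wF N τ a b x y * wF N τ c d x' y') • UU hN ((a : ℤ) - c) ((b : ℤ) - d) =
      ∑ a ∈ Finset.range N, ∑ b ∈ Finset.range N,
      (wF N τ (c + a) (d + b) x y * wF N τ c d x' y') • UU hN a b := by
    intro c d
    rw [← sum_periodic N (fun a => ∑ b ∈ Finset.range N,
      (wF N τ a b x y * wF N τ c d x' y') • UU hN (a - c) ((b : ℤ) - d)) ?_ c]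
    · refine Finset.sum_congr rfl fun a _ => ?_
      rw [← sum_periodic N (fun b =>
        (wF N τ (a + c) b x y * wF N τ c d x' y') • UU hN (a + c - c) (b - d)) ?_ d]
      · refine Finset.sum_congr rfl fun b _ => ?_
        rw [add_sub_cancel_right, add_sub_cancel_right, add_comm c, add_comm d]
      · intro b
        rw [wF_add_right hN, add_sub_right_comm b, UU_right]
    · intro a
      refine Finset.sum_congr rfl fun b _ => ?_
      rw [wF_add_left hN, add_sub_right_comm, UU_left]
  have e2 : ∑ c ∈ Finset.range N, ∑ d ∈ Finset.range N, ∑ a ∈ Finset.range N,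
      ∑ b ∈ Finset.range N,
      (wF N τ a b x y * wF N τ c d x' y') • UU hN ((a : ℤ) - c) ((b : ℤ) - d) =
      ∑ p ∈ Finset.range N ×ˢ Finset.range N, conv N τ p.1 p.2 x y x' y' • UU hN p.1 p.2 := by
    simp only [e1]
    rw [Finset.sum_product' (Finset.range N) (Finset.range N)
      (fun a b => conv N τ a b x y x' y' • UU hN a b)]
    unfold conv
    simp only [Finset.sum_smul]
    rw [Finset.sum_congr rfl fun c _ => Finset.sum_comm, Finset.sum_comm]
    refine Finset.sum_congr rfl fun a _ => ?_
    rw [Finset.sum_congr rfl fun c _ => Finset.sum_comm, Finset.sum_comm]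
  rw [e2, Finset.sum_eq_single (0, 0)]
  · simp [UU_zero]
  · rintro ⟨a, b⟩ hp hne
    simp only [Finset.mem_product, Finset.mem_range] at hp
    rw [h0, zero_smul]
    rintro ⟨h1, h2⟩
    apply hne
    ext
    · exact Nat.eq_zero_of_dvd_of_lt (by exact_mod_cast h1) hp.1
    · exact Nat.eq_zero_of_dvd_of_lt (by exact_mod_cast h2) hp.2
  · intro h
    simp [Nat.pos_of_ne_zero hN] at h

lemma Wcoef_eq {N : ℕ} (α : Fin N × Fin N) (ξ ζ τ : ℂ) :
    Wcoef N α ξ ζ τ = (1 / N) * wF N τ (α.1 : ℕ) (α.2 : ℕ) ξ (ζ / N) := by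
  rw [Wcoef, jTheta_shift, jTheta_shift, wF]
  push_cast
  rw [show (((α.1 : ℕ) : ℂ) / N) ^ 2 * τ + 2 * (((α.1 : ℕ) : ℂ) / N) *
      (ξ + ζ / N + 1 / 2 + ((α.2 : ℕ) : ℂ) / N) = 2 * (((α.1 : ℕ) : ℂ) / N) * ξ +
      ((((α.1 : ℕ) : ℂ) / N) ^ 2 * τ + 2 * (((α.1 : ℕ) : ℂ) / N) *
      (ζ / N + 1 / 2 + ((α.2 : ℕ) : ℂ) / N)) by ring, eπ_add, add_assoc ξ]
  have h := eπ_ne ((((α.1 : ℕ) : ℂ) / N) ^ 2 * τ + 2 * (((α.1 : ℕ) : ℂ) / N) *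
      (ζ / N + 1 / 2 + ((α.2 : ℕ) : ℂ) / N))
  generalize eπ ((((α.1 : ℕ) : ℂ) / N) ^ 2 * τ + 2 * (((α.1 : ℕ) : ℂ) / N) *
      (ζ / N + 1 / 2 + ((α.2 : ℕ) : ℂ) / N)) = A at h ⊢
  generalize tT τ (ζ / N + (((α.1 : ℕ) : ℂ) * τ + ((α.2 : ℕ) : ℂ)) / N) = B
  generalize tT τ (ξ + (ζ / N + (((α.1 : ℕ) : ℂ) * τ + ((α.2 : ℕ) : ℂ)) / N)) = B'
  generalize eπ (2 * (((α.1 : ℕ) : ℂ) / N) * ξ) = E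
  field_simp

lemma tT_zeta_ne {N : ℕ} (hN : N ≠ 0) {ξ ζ τ : ℂ} (hτ : 0 < τ.im) (h : Rgeneric N ξ ζ τ) :
    tT τ ζ ≠ 0 := by
  have hN' : (N : ℂ) ≠ 0 := by exact_mod_cast hN
  obtain ⟨h0, h1, -⟩ := h
  intro hz
  obtain ⟨n, m, e⟩ := (tT_eq_zero_iff hτ (ξ + ζ) h0 ζ).1 hz
  have hNz : (0 : ℤ) < N := by exact_mod_cast Nat.pos_of_ne_zero hN
  obtain ⟨a, ha⟩ := Int.eq_ofNat_of_zero_le (Int.emod_nonneg (-m) hNz.ne')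
  obtain ⟨b, hb⟩ := Int.eq_ofNat_of_zero_le (Int.emod_nonneg (-n) hNz.ne')
  have ha' : a < N := by
    have := Int.emod_lt_of_pos (-m) hNz
    rw [ha] at this
    exact_mod_cast this
  have hb' : b < N := by
    have := Int.emod_lt_of_pos (-n) hNz
    rw [hb] at this
    exact_mod_cast this
  have hda := Int.emod_add_mul_ediv (-m) N
  have hdb := Int.emod_add_mul_ediv (-n) N
  rw [ha] at hda
  rw [hb] at hdb
  generalize (-m) / (N : ℤ) = k at hda
  generalize (-n) / (N : ℤ) = l at hdb
  have hda' : (a : ℂ) + N * k = -m := by exact_mod_cast hda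
  have hdb' : (b : ℂ) + N * l = -n := by exact_mod_cast hdb
  have := h1 (⟨a, ha'⟩, ⟨b, hb'⟩)
  rw [jTheta_shift] at this
  apply this
  have hz : tT τ (ζ / N + ((a : ℂ) * τ + b) / N) = 0 := by
    rw [tT_eq_zero_iff hτ (ξ + ζ) h0]
    refine ⟨-l, -k, ?_⟩
    rw [e]
    push_cast
    field_simp
    linear_combination τ * hda' + hdb'
  rw [hz, mul_zero]

lemma pt2_smul {N : ℕ} (c : ℂ) (M : Matrix (Fin N × Fin N) (Fin N × Fin N) ℂ) :
    pt2 (c • M) = c • pt2 M := rfl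

lemma pt2_sum {N : ℕ} {ι : Type*} (s : Finset ι)
    (M : ι → Matrix (Fin N × Fin N) (Fin N × Fin N) ℂ) :
    pt2 (∑ i ∈ s, M i) = ∑ i ∈ s, pt2 (M i) := by
  ext a b
  simp [pt2, Matrix.sum_apply]

lemma pt2_kron {N : ℕ} (A B : Matrix (Fin N) (Fin N) ℂ) : pt2 (A ⊗ₖ B) = A ⊗ₖ Bᵀ := by
  ext a b
  simp [pt2, Matrix.kroneckerMap_apply]

lemma Pflip_conj {N : ℕ} (M : Matrix (Fin N × Fin N) (Fin N × Fin N) ℂ) :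
    Pflip N * M * Pflip N = M.submatrix Prod.swap Prod.swap := by
  have h1 : ∀ a b, (Pflip N * M) a b = M a.swap b := by
    intro a b
    rw [Matrix.mul_apply, Finset.sum_eq_single a.swap]
    · simp [Pflip]
    · intro c _ hc
      rw [Pflip, Matrix.of_apply, if_neg, zero_mul]
      rintro ⟨e1, e2⟩
      exact hc (Prod.ext e2.symm e1.symm)
    · intro h; exact absurd (Finset.mem_univ _) h
  ext a b
  rw [Matrix.mul_apply, Finset.sum_eq_single b.swap]
  · rw [h1]; simp [Pflip]
  · intro c _ hc
    rw [Pflip, Matrix.of_apply, if_neg, mul_zero]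
    rintro ⟨e1, e2⟩
    exact hc (Prod.ext e1 e2)
  · intro h; exact absurd (Finset.mem_univ _) h

/-- diagonal entries of `g^{1/2}`. -/
def dd (N : ℕ) (j : Fin N) : ℂ := eπ ((((j : ℕ) : ℂ) + 1) / N)

lemma dd_ne (N : ℕ) (j : Fin N) : dd N j ≠ 0 := eπ_ne _

lemma Rmat_apply {N : ℕ} (ξ ζ τ : ℂ) (a b : Fin N × Fin N) :
    Rmat N ξ ζ τ a b = dd N a.1 * dd N a.2 * Zmat N ξ ζ τ a b * (dd N b.1 * dd N b.2)⁻¹ := by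
  have hD : gHalf N ⊗ₖ gHalf N = Matrix.diagonal fun i : Fin N × Fin N => dd N i.1 * dd N i.2 := by
    rw [gHalf, Matrix.diagonal_kronecker_diagonal]
    rfl
  have hDi : (gHalf N ⊗ₖ gHalf N)⁻¹ =
      Matrix.diagonal fun i : Fin N × Fin N => (dd N i.1 * dd N i.2)⁻¹ := by
    apply Matrix.inv_eq_right_inv
    rw [hD, Matrix.diagonal_mul_diagonal, ← Matrix.diagonal_one]
    congr 1
    ext i
    exact mul_inv_cancel₀ (mul_ne_zero (dd_ne _ _) (dd_ne _ _))
  rw [Rmat, hDi, hD, Matrix.mul_diagonal, Matrix.diagonal_mul]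

lemma pt2_R {N : ℕ} (ξ ζ τ : ℂ) : pt2 (Rmat N ξ ζ τ) =
    (Matrix.diagonal fun i : Fin N × Fin N => dd N i.1 * (dd N i.2)⁻¹) * pt2 (Zmat N ξ ζ τ) *
      (Matrix.diagonal fun i : Fin N × Fin N => dd N i.2 * (dd N i.1)⁻¹) := by
  ext a b
  rw [Matrix.mul_diagonal, Matrix.diagonal_mul]
  simp only [pt2, Matrix.of_apply, Rmat_apply]
  rw [mul_inv]
  ring

lemma pt2_PR {N : ℕ} (ξ ζ τ : ℂ) : pt2 (Pflip N * Rmat N ξ ζ τ * Pflip N) =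
    (Matrix.diagonal fun i : Fin N × Fin N => dd N i.1 * (dd N i.2)⁻¹) *
      pt2 (Pflip N * Zmat N ξ ζ τ * Pflip N) *
      (Matrix.diagonal fun i : Fin N × Fin N => dd N i.2 * (dd N i.1)⁻¹) := by
  rw [Pflip_conj, Pflip_conj]
  ext a b
  rw [Matrix.mul_diagonal, Matrix.diagonal_mul]
  simp only [pt2, Matrix.of_apply, Matrix.submatrix_apply, Rmat_apply, Prod.swap_prod_mk]
  rw [mul_inv]
  ring

lemma dd_diag {N : ℕ} : (Matrix.diagonal fun i : Fin N × Fin N => dd N i.2 * (dd N i.1)⁻¹) *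
    (Matrix.diagonal fun i : Fin N × Fin N => dd N i.1 * (dd N i.2)⁻¹) = 1 := by
  rw [Matrix.diagonal_mul_diagonal, ← Matrix.diagonal_one]
  congr 1
  ext i
  have h1 := dd_ne N i.1
  have h2 := dd_ne N i.2
  field_simp

lemma dd_diag' {N : ℕ} : (Matrix.diagonal fun i : Fin N × Fin N => dd N i.1 * (dd N i.2)⁻¹) *
    (Matrix.diagonal fun i : Fin N × Fin N => dd N i.2 * (dd N i.1)⁻¹) = 1 := by
  rw [Matrix.diagonal_mul_diagonal, ← Matrix.diagonal_one]
  congr 1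
  ext i
  have h1 := dd_ne N i.1
  have h2 := dd_ne N i.2
  field_simp

/-- scalar prefactor. -/
def pref (N : ℕ) (ξ ζ τ : ℂ) : ℂ :=
  eπ (ξ * (2 / N - 2)) * (kappaNum N ξ ζ τ / kappaDen N ξ ζ τ) * tT τ ζ / tT τ (ξ + ζ)

lemma pt2_Z {N : ℕ} (hN : N ≠ 0) (ξ ζ τ : ℂ) : pt2 (Zmat N ξ ζ τ) =
    (pref N ξ ζ τ * (1 / N)) • ∑ a ∈ Finset.range N, ∑ b ∈ Finset.range N,
      wF N τ a b ξ (ζ / N) • UU hN a b := by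
  have : Zmat N ξ ζ τ = pref N ξ ζ τ •
    ∑ α : Fin N × Fin N, Wcoef N α ξ ζ τ • (Imat N α ⊗ₖ (Imat N α)⁻¹) := rfl
  rw [this, pt2_smul, pt2_sum, mul_smul]
  simp only [pt2_smul, pt2_kron, K_Imat hN, Wcoef_eq, mul_smul]
  rw [← Finset.smul_sum, Fintype.sum_prod_type]
  congr 2
  rw [← Fin.sum_univ_eq_sum_range (fun a => ∑ b ∈ Finset.range N,
      wF N τ a b ξ (ζ / N) • UU hN a b)]
  refine Finset.sum_congr rfl fun a _ => ?_
  rw [← Fin.sum_univ_eq_sum_range (fun b => wF N τ (a : ℕ) b ξ (ζ / N) • UU hN (a : ℕ) b)]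

lemma pt2_PZ {N : ℕ} (hN : N ≠ 0) (ξ ζ τ : ℂ) : pt2 (Pflip N * Zmat N ξ ζ τ * Pflip N) =
    (pref N ξ ζ τ * (1 / N)) • ∑ a ∈ Finset.range N, ∑ b ∈ Finset.range N,
      wF N τ a b ξ (ζ / N) • UU hN (-a) (-b) := by
  have : Zmat N ξ ζ τ = pref N ξ ζ τ •
    ∑ α : Fin N × Fin N, Wcoef N α ξ ζ τ • (Imat N α ⊗ₖ (Imat N α)⁻¹) := rfl
  have hk : ∀ A B : Matrix (Fin N) (Fin N) ℂ, Pflip N * (A ⊗ₖ B) * Pflip N = B ⊗ₖ A := by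
    intro A B
    rw [Pflip_conj]
    ext a b
    simp [Matrix.kroneckerMap_apply, mul_comm]
  rw [this, Matrix.mul_smul, Matrix.smul_mul, Matrix.mul_sum, Matrix.sum_mul,
    pt2_smul, pt2_sum, mul_smul]
  simp only [Matrix.mul_smul, Matrix.smul_mul, hk, pt2_smul, pt2_kron, K_Imat' hN, Wcoef_eq,
    mul_smul]
  rw [← Finset.smul_sum, Fintype.sum_prod_type]
  congr 2
  rw [← Fin.sum_univ_eq_sum_range (fun a => ∑ b ∈ Finset.range N,
      wF N τ a b ξ (ζ / N) • UU hN (-a) (-b))]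
  refine Finset.sum_congr rfl fun a _ => ?_
  rw [← Fin.sum_univ_eq_sum_range (fun b => wF N τ (a : ℕ) b ξ (ζ / N) • UU hN (-(a : ℕ)) (-b))]

lemma pref_mul {N : ℕ} (hN : N ≠ 0) {ξ ζ τ : ℂ} (hτ : 0 < τ.im) (hζ : 0 < ζ.im)
    (h1 : Rgeneric N ξ ζ τ) (h2 : Rgeneric N (-ξ - N * ζ) ζ τ) :
    pref N ξ ζ τ * pref N (-ξ - N * ζ) ζ τ * (tT τ ξ * tT τ (-ξ - N * ζ)) = tT τ ζ ^ 2 := by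
  have hN' : (N : ℂ) ≠ 0 := by exact_mod_cast hN
  have hk := kappa_cross hN hτ hζ h1.2.2 h2.2.2
  have t1 : tT τ (ξ + ζ) ≠ 0 := h1.1
  have t2 : tT τ (-ξ - N * ζ + ζ) ≠ 0 := h2.1
  have he : eπ (ξ * (2 / N - 2)) * eπ ((-ξ - N * ζ) * (2 / N - 2)) * eπ (2 * ζ - 2 * N * ζ) = 1 := by
    rw [← eπ_add, ← eπ_add, ← eπ_zero]
    congr 1
    field_simp
    ring
  unfold pref
  generalize kappaNum N ξ ζ τ / kappaDen N ξ ζ τ = k1 at *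
  generalize kappaNum N (-ξ - N * ζ) ζ τ / kappaDen N (-ξ - N * ζ) ζ τ = k2 at *
  generalize eπ (ξ * (2 / N - 2)) = e1 at *
  generalize eπ ((-ξ - N * ζ) * (2 / N - 2)) = e2 at *
  generalize eπ (2 * ζ - 2 * N * ζ) = e3 at *
  generalize tT τ (ξ + ζ) = A at *
  generalize tT τ (-ξ - N * ζ + ζ) = B at *
  generalize tT τ (-ξ - N * ζ) = C at *
  field_simp
  linear_combination e1 * e2 * tT τ ζ ^ 2 * hk + A * B * tT τ ζ ^ 2 * he

theorem crossing_final (N : ℕ) (hN2 : 2 ≤ N) (ξ ζ τ : ℂ)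
    (hτ : 0 < τ.im) (hζ : 0 < ζ.im)
    (h1 : Rgeneric N ξ ζ τ) (h2 : Rgeneric N (-ξ - N * ζ) ζ τ) :
    pt2 (Rmat N ξ ζ τ) * pt2 (Pflip N * Rmat N (-ξ - N * ζ) ζ τ * Pflip N) = 1 := by
  have hN : N ≠ 0 := by omega
  have hN' : (N : ℂ) ≠ 0 := by exact_mod_cast hN
  have hz := tT_zeta_ne hN hτ h1
  have hx : ξ + (-ξ - N * ζ) = -(N * ζ) := by ring
  have key : pt2 (Zmat N ξ ζ τ) * pt2 (Pflip N * Zmat N (-ξ - N * ζ) ζ τ * Pflip N) = 1 := by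
    have hs := conv_sum hN τ ξ (ζ / N) (-ξ - N * ζ) (ζ / N)
      (fun c d hcd => conv_zero hN hτ c d _ _ ζ hz hx hcd)
    have ho := conv_one hN hτ _ _ ζ hz hx
    have hp := pref_mul hN hτ hζ h1 h2
    rw [pt2_Z hN, pt2_PZ hN, Matrix.smul_mul, Matrix.mul_smul, smul_smul, Finset.mul_sum]
    have e : ∑ c ∈ Finset.range N, (∑ a ∈ Finset.range N, ∑ b ∈ Finset.range N,
        wF N τ a b ξ (ζ / N) • UU hN a b) * ∑ d ∈ Finset.range N,
        wF N τ c d (-ξ - N * ζ) (ζ / N) • UU hN (-c) (-d) =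
        conv N τ 0 0 ξ (ζ / N) (-ξ - N * ζ) (ζ / N) • 1 := by
      rw [← hs]
      refine Finset.sum_congr rfl fun c _ => ?_
      rw [Finset.mul_sum]
      refine Finset.sum_congr rfl fun d _ => ?_
      rw [Finset.sum_mul]
      refine Finset.sum_congr rfl fun a _ => ?_
      rw [Finset.sum_mul]
      refine Finset.sum_congr rfl fun b _ => ?_
      rw [Matrix.smul_mul, Matrix.mul_smul, smul_smul, UU_mul, ← sub_eq_add_neg, ← sub_eq_add_neg]
    rw [e, smul_smul]
    have hc : pref N ξ ζ τ * (1 / N) * (pref N (-ξ - N * ζ) ζ τ * (1 / N)) *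
        conv N τ 0 0 ξ (ζ / N) (-ξ - N * ζ) (ζ / N) = 1 := by
      have hz2 : tT τ ζ ^ 2 ≠ 0 := pow_ne_zero 2 hz
      generalize conv N τ 0 0 ξ (ζ / N) (-ξ - N * ζ) (ζ / N) = V at *
      generalize pref N ξ ζ τ = p1 at *
      generalize pref N (-ξ - N * ζ) ζ τ = p2 at *
      have h3 : p1 * p2 * V = N ^ 2 :=
        mul_left_cancel₀ hz2 (by linear_combination p1 * p2 * ho + N ^ 2 * hp)
      field_simp
      linear_combination h3
    rw [hc, one_smul]
  rw [pt2_R, pt2_PR]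
  set Δ := (Matrix.diagonal fun i : Fin N × Fin N => dd N i.1 * (dd N i.2)⁻¹) with hΔ
  set Δ' := (Matrix.diagonal fun i : Fin N × Fin N => dd N i.2 * (dd N i.1)⁻¹) with hΔ'
  have d1 : Δ' * Δ = 1 := dd_diag
  have d2 : Δ * Δ' = 1 := dd_diag'
  calc Δ * pt2 (Zmat N ξ ζ τ) * Δ' * (Δ * pt2 (Pflip N * Zmat N (-ξ - N * ζ) ζ τ * Pflip N) * Δ')
      = Δ * (pt2 (Zmat N ξ ζ τ) * (Δ' * Δ) *
          pt2 (Pflip N * Zmat N (-ξ - N * ζ) ζ τ * Pflip N)) * Δ' := by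
        simp only [Matrix.mul_assoc]
    _ = 1 := by rw [d1, Matrix.mul_one, key, Matrix.mul_one, d2]

/-- Crossing symmetry: `R₁₂(z)^{t₂} R₂₁(z⁻¹q^{-N})^{t₂} = Id`, where `z = eπ ξ`,
`z⁻¹ q^{-N} = eπ (-ξ - N ζ)` and `R₂₁(w) = P R(w) P`. -/
theorem belavin_crossing_symmetry (N : ℕ) (hN : 2 ≤ N) (ξ ζ τ : ℂ)
    (hτ : 0 < τ.im) (hζ : 0 < ζ.im)
    (h1 : Rgeneric N ξ ζ τ) (h2 : Rgeneric N (-ξ - N * ζ) ζ τ) :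
    pt2 (Rmat N ξ ζ τ) * pt2 (Pflip N * Rmat N (-ξ - N * ζ) ζ τ * Pflip N) = 1 := by
  exact crossing_final N hN ξ ζ τ hτ hζ h1 h2

end
end

section
/- The function τ_N(z) = z^{2/N−2} Θ_{q^{2N}}(q z²)/Θ_{q^{2N}}(q z^{−2}) is q^N-periodic and odd under inversion: for every z ∈ ℂ with z ∉ ℝ_{≤0} such that z² ∉ {q^r : r ∈ ℤ} (so that no theta factor vanishes), one has τ_N(q^N z) = τ_N(z) and τ_N(z^{−1}) = τ_N(z)^{−1}. -/
open Complex

noncomputable section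

/-- the function `𝒰(x) = q^{2/N-2} Θ_{q^{2N}}(q²x²) Θ_{q^{2N}}(q²x⁻²) /
(Θ_{q^{2N}}(x²) Θ_{q^{2N}}(x⁻²))` for a real number `q ∈ (0,1)`. -/
def Ureal (N : ℕ) (q : ℝ) (x : ℂ) : ℂ :=
  ((q ^ ((2 : ℝ) / N - 2) : ℝ) : ℂ) * ThetaF ((q : ℂ) ^ (2 * N)) ((q : ℂ) ^ 2 * x ^ 2) *
    ThetaF ((q : ℂ) ^ (2 * N)) ((q : ℂ) ^ 2 * (x⁻¹) ^ 2) /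
    (ThetaF ((q : ℂ) ^ (2 * N)) (x ^ 2) * ThetaF ((q : ℂ) ^ (2 * N)) ((x⁻¹) ^ 2))

/-- `τ_N(z) = z^{2/N-2} Θ_{q^{2N}}(qz²)/Θ_{q^{2N}}(qz⁻²)` with the principal
complex power. -/
def tauC (N : ℕ) (q : ℝ) (z : ℂ) : ℂ :=
  z ^ ((2 : ℂ) / N - 2) * ThetaF ((q : ℂ) ^ (2 * N)) ((q : ℂ) * z ^ 2) /
    ThetaF ((q : ℂ) ^ (2 * N)) ((q : ℂ) * (z⁻¹) ^ 2)

lemma aux_poch1_step (x s : ℂ) (hs : ‖s‖ < 1) : poch1 x s = (1 - x) * poch1 (s * x) s := by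
  unfold poch1
  have hm : Multipliable (fun n : ℕ => (1 - x * s ^ (n + 1))) := by
    have : Multipliable (fun n : ℕ => (1 + (-(x * s) * s ^ n))) := by
      apply multipliable_one_add_of_summable
      simp only [norm_mul, norm_pow]
      exact (summable_geometric_of_lt_one (norm_nonneg _) hs).mul_left _
    refine this.congr ?_
    intro n
    ring
  rw [tprod_eq_zero_mul' (f := fun n : ℕ => 1 - x * s ^ n) hm]
  congr 1
  · simp
  · refine tprod_congr fun n => ?_
    ring

lemma aux_Theta_step (x s : ℂ) (hs : ‖s‖ < 1) (hs0 : s ≠ 0) (hx : x ≠ 0) :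
    ThetaF s (s * x) = -x⁻¹ * ThetaF s x := by
  unfold ThetaF
  have h1 : s * (s * x)⁻¹ = x⁻¹ := by field_simp
  rw [h1, aux_poch1_step x s hs, aux_poch1_step x⁻¹ s hs]
  field_simp
  ring

/-- `τ_N` is `q^N`-periodic and odd under inversion. -/
theorem tauN_periodic_and_inversion (N : ℕ) (hN : 2 ≤ N) (q : ℝ)
    (hq0 : 0 < q) (hq1 : q < 1) (z : ℂ)
    (hz : ∀ r : ℝ, r ≤ 0 → z ≠ (r : ℂ)) (hz2 : ∀ r : ℤ, z ^ 2 ≠ (q : ℂ) ^ r) :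
    tauC N q ((q : ℂ) ^ N * z) = tauC N q z ∧ tauC N q z⁻¹ = (tauC N q z)⁻¹ := by
  have hz0 : z ≠ 0 := by simpa using hz 0 le_rfl
  have hqc : (q : ℂ) ≠ 0 := by exact_mod_cast hq0.ne'
  have hN0 : (N : ℂ) ≠ 0 := by
    have : N ≠ 0 := by omega
    exact_mod_cast this
  constructor
  · have hs : ‖(q : ℂ) ^ (2 * N)‖ < 1 := by
      rw [norm_pow, Complex.norm_real, Real.norm_of_nonneg hq0.le]
      exact pow_lt_one₀ hq0.le hq1 (by omega)
    have hs0 : (q : ℂ) ^ (2 * N) ≠ 0 := pow_ne_zero _ hqc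
    have hpow : ((q : ℂ) ^ N * z) ^ ((2 : ℂ) / N - 2)
        = (q : ℂ) ^ 2 * ((q : ℂ) ^ (2 * N))⁻¹ * z ^ ((2 : ℂ) / N - 2) := by
      rw [Complex.cpow_def_of_ne_zero (mul_ne_zero (pow_ne_zero _ hqc) hz0),
        Complex.cpow_def_of_ne_zero hz0]
      have hl : Complex.log ((q : ℂ) ^ N * z) = N * (Real.log q : ℂ) + Complex.log z := by
        rw [← Complex.ofReal_pow, Complex.log_ofReal_mul (pow_pos hq0 N) hz0, Real.log_pow]
        push_cast
        rfl
      have he : (q : ℂ) = Complex.exp (Real.log q : ℂ) := by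
        rw [← Complex.ofReal_exp, Real.exp_log hq0]
      have hL : (N * (Real.log q : ℂ) + Complex.log z) * ((2 : ℂ) / N - 2)
          = ((2 : ℕ) : ℂ) * (Real.log q : ℂ) + -(((2 * N : ℕ) : ℂ) * (Real.log q : ℂ))
            + Complex.log z * ((2 : ℂ) / N - 2) := by
        push_cast
        field_simp
        ring
      rw [hl, hL, Complex.exp_add, Complex.exp_add, Complex.exp_neg, Complex.exp_nat_mul,
        Complex.exp_nat_mul, ← he]
    have hA := aux_Theta_step ((q : ℂ) * z ^ 2) _ hs hs0 (mul_ne_zero hqc (pow_ne_zero _ hz0))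
    have hy : (q : ℂ) * (((q : ℂ) ^ N * z)⁻¹) ^ 2 ≠ 0 :=
      mul_ne_zero hqc (pow_ne_zero _ (inv_ne_zero (mul_ne_zero (pow_ne_zero _ hqc) hz0)))
    have hB := aux_Theta_step _ _ hs hs0 hy
    have e1 : (q : ℂ) ^ (2 * N) * ((q : ℂ) * z ^ 2) = (q : ℂ) * ((q : ℂ) ^ N * z) ^ 2 := by ring
    have e2 : (q : ℂ) ^ (2 * N) * ((q : ℂ) * (((q : ℂ) ^ N * z)⁻¹) ^ 2)
        = (q : ℂ) * (z⁻¹) ^ 2 := by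
      rw [mul_comm 2 N, pow_mul]
      field_simp
    rw [e1] at hA
    rw [e2] at hB
    unfold tauC
    rw [hpow, hA, hB]
    generalize ThetaF ((q : ℂ) ^ (2 * N)) ((q : ℂ) * (((q : ℂ) ^ N * z)⁻¹) ^ 2) = B
    rw [mul_comm 2 N, pow_mul]
    by_cases hB0 : B = 0
    · simp [hB0]
    · field_simp
  · have harg : z.arg ≠ Real.pi := by
      intro h
      rw [Complex.arg_eq_pi_iff] at h
      exact hz z.re h.1.le (Complex.ext (by simp) (by simpa using h.2))
    unfold tauC
    rw [Complex.inv_cpow _ _ harg, inv_inv, inv_div]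
    generalize z ^ ((2 : ℂ) / N - 2) = w
    rw [div_eq_mul_inv, div_eq_mul_inv, mul_inv]
    ring

end
end
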